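/- Under the Hecke-pair setup below, assume additionally that a(n) + a′(n) ≠ 0 for some n, and that |f(x + iy)| ≤ 𝒜 y^{−σ₀} and |f′(x + iy)| ≤ 𝒜 y^{−σ₀} for all x ∈ ℝ, y > 0 and some constant 𝒜. Then there exist d > 0 and T₀ > 0 such that for all T ≥ T₀ the real-valued function t ↦ R(t) has at least d·T sign changes in [T, 2T]; equivalently, the number N₀(T) of zeros of odd order of t ↦ L(σ₀ + it) + L′(σ₀ + it) with 0 ≤ t ≤ T satisfies liminf_{T→∞} N₀(T)/T > d. -/

import Mathlib

/-- The sum `f(z) = ∑_{n≥1} a(n) e^{2πinz}` attached to coefficients `a : ℕ → ℝ`. -/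
noncomputable def heckeSum (a : ℕ → ℝ) (z : ℂ) : ℂ :=
  ∑' n : ℕ, (a (n + 1) : ℂ) * Complex.exp (2 * Real.pi * Complex.I * ((n : ℂ) + 1) * z)

open MeasureTheory FourierTransform in
/-- The `L²` Fourier transform of an integrable function is given by the Fourier integral. -/
theorem fourier_toLp_ae_eq {g : ℝ → ℂ} (h₁ : Integrable g) (h₂ : MemLp g 2) :
    (𝓕 (h₂.toLp g) : Lp ℂ 2 (volume : Measure ℝ)) =ᵐ[volume] 𝓕 g := by
  have hcont : Continuous (𝓕 g) :=
    VectorFourier.fourierIntegral_continuous Real.continuous_fourierChar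
      (by exact continuous_inner) h₁
  refine ae_eq_of_integral_contDiff_smul_eq
    ((Lp.memLp _).locallyIntegrable one_le_two) hcont.locallyIntegrable fun φ φ_smooth φ_cpt ↦ ?_
  have hφ₁ : HasCompactSupport (Complex.ofRealCLM ∘ φ) := φ_cpt.comp_left rfl
  have hφ₂ : ContDiff ℝ (⊤ : ℕ∞) (Complex.ofRealCLM ∘ φ) := by fun_prop
  let ψ := hφ₁.toSchwartzMap hφ₂
  have hψ : ∀ x, ψ x = (φ x : ℂ) := fun x ↦ by simp [ψ]
  have key := congrArg (fun D : TemperedDistribution ℝ ℂ ↦ D ψ)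
    (Lp.fourier_toTemperedDistribution_eq (h₂.toLp g))
  simp only [TemperedDistribution.fourier_apply, Lp.toTemperedDistribution_apply] at key
  have e₁ : ∫ x, φ x • (𝓕 (h₂.toLp g) : Lp ℂ 2 (volume : Measure ℝ)) x =
      ∫ x, ψ x • (𝓕 (h₂.toLp g) : Lp ℂ 2 (volume : Measure ℝ)) x := by
    simp [hψ]
  have e₂ : ∫ x, (𝓕 ψ) x • (h₂.toLp g) x = ∫ x, (𝓕 ψ) x • g x := by
    refine integral_congr_ae ?_
    filter_upwards [h₂.coeFn_toLp] with x hx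
    rw [hx]
  have e₃ : ∫ x, (𝓕 (ψ : ℝ → ℂ)) x • g x = ∫ x, (ψ x) • 𝓕 g x := by
    have := VectorFourier.integral_fourierIntegral_smul_eq_flip
      (L := innerₗ ℝ) Real.continuous_fourierChar continuous_inner (ψ.integrable (μ := volume)) h₁
    rwa [flip_innerₗ] at this
  rw [e₁, ← key, e₂, SchwartzMap.fourier_coe, e₃]
  simp [hψ]

open MeasureTheory FourierTransform in
/-- Plancherel's theorem for functions in `L¹ ∩ L²`. -/
theorem integral_norm_sq_fourier {g : ℝ → ℂ} (h₁ : Integrable g) (h₂ : MemLp g 2) :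
    Integrable (fun ξ ↦ ‖𝓕 g ξ‖ ^ 2) ∧ ∫ ξ, ‖𝓕 g ξ‖ ^ 2 = ∫ x, ‖g x‖ ^ 2 := by
  have hae := fourier_toLp_ae_eq h₁ h₂
  have hmem : MemLp (𝓕 g) 2 := (memLp_congr_ae hae).1 (Lp.memLp _)
  have key : ∀ {h : ℝ → ℂ} (hh : MemLp h 2), ∫ x, ‖h x‖ ^ 2 = ‖hh.toLp h‖ ^ 2 := by
    intro h hh
    rw [← @inner_self_eq_norm_sq ℂ, L2.inner_def]
    have : ∫ x, inner ℂ ((hh.toLp h) x) ((hh.toLp h) x) = ∫ x, ((‖h x‖ ^ 2 : ℝ) : ℂ) := by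
      refine integral_congr_ae ?_
      filter_upwards [hh.coeFn_toLp] with x hx
      rw [hx, inner_self_eq_norm_sq_to_K]
      simp
    rw [this, integral_complex_ofReal]
    simp
  refine ⟨hmem.integrable_norm_pow (by norm_num), ?_⟩
  rw [key hmem, key h₂, ← Lp.norm_fourier_eq (h₂.toLp g)]
  congr 2
  exact Lp.ext (hmem.coeFn_toLp.trans hae.symm)

theorem cpow_ofReal_mul {r : ℝ} (hr : 0 < r) {z : ℂ} (hz : z ≠ 0) (s : ℂ) :
    ((r : ℂ) * z) ^ s = (r : ℂ) ^ s * z ^ s := by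
  have hr' : (r : ℂ) ≠ 0 := Complex.ofReal_ne_zero.2 hr.ne'
  rw [Complex.cpow_def_of_ne_zero (mul_ne_zero hr' hz), Complex.cpow_def_of_ne_zero hr',
    Complex.cpow_def_of_ne_zero hz, Complex.log_ofReal_mul hr hz, Complex.ofReal_log hr.le,
    add_mul, Complex.exp_add]

open MeasureTheory Set in
theorem integrableOn_cpow_mul_exp_neg_mul {s w : ℂ} (hs : 0 < s.re) (hw : 0 < w.re) :
    IntegrableOn (fun t : ℝ ↦ (t : ℂ) ^ (s - 1) * Complex.exp (-(w * t))) (Ioi 0) := by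
  have hint := integrableOn_rpow_mul_exp_neg_mul_rpow (p := 1) (s := s.re - 1) (b := w.re)
    (by linarith) one_pos hw
  refine hint.mono' ?_ ?_
  · refine ContinuousOn.aestronglyMeasurable (fun t ht ↦ ContinuousAt.continuousWithinAt ?_)
      measurableSet_Ioi
    refine ((Complex.continuousAt_ofReal_cpow_const _ _ (Or.inr (ne_of_gt ht)))).mul ?_
    fun_prop
  · filter_upwards [ae_restrict_mem measurableSet_Ioi] with t ht
    rw [norm_mul, Complex.norm_cpow_eq_rpow_re_of_pos ht, Complex.norm_exp]
    simp

open MeasureTheory Set in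
/-- The Gamma integral with a complex rate in the right half-plane. -/
theorem integral_cpow_mul_exp_neg_mul_of_re_pos {s w : ℂ} (hs : 0 < s.re) (hw : 0 < w.re) :
    ∫ t : ℝ in Ioi 0, (t : ℂ) ^ (s - 1) * Complex.exp (-(w * t)) =
      w ^ (-s) * Complex.Gamma s := by
  let U : Set ℂ := {z | 0 < z.re}
  have hU : IsOpen U := isOpen_lt continuous_const Complex.continuous_re
  have hUc : IsPreconnected U := (convex_halfSpace_re_gt 0).isPreconnected
  have hL : DifferentiableOn ℂ
      (fun z : ℂ ↦ ∫ t : ℝ in Ioi 0, (t : ℂ) ^ (s - 1) * Complex.exp (-(z * t))) U := by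
    intro z hz
    have hz : 0 < z.re := hz
    refine (hasDerivAt_integral_of_dominated_loc_of_deriv_le
      (μ := volume.restrict (Ioi (0 : ℝ)))
      (F := fun (z : ℂ) (t : ℝ) ↦ (t : ℂ) ^ (s - 1) * Complex.exp (-(z * t)))
      (F' := fun (y : ℂ) (t : ℝ) ↦ (t : ℂ) ^ (s - 1) * (Complex.exp (-(y * t)) * (-t)))
      (bound := fun t : ℝ ↦ t ^ s.re * Real.exp (-(z.re / 2) * t ^ (1 : ℝ)))
      (Metric.ball_mem_nhds z (half_pos hz)) ?_ (integrableOn_cpow_mul_exp_neg_mul hs hz) ?_ ?_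
      ?_ ?_).2.differentiableAt.differentiableWithinAt
    · filter_upwards [hU.mem_nhds hz] with y hy
      exact (integrableOn_cpow_mul_exp_neg_mul hs hy).aestronglyMeasurable
    · refine ContinuousOn.aestronglyMeasurable (fun t ht ↦ ContinuousAt.continuousWithinAt ?_)
        measurableSet_Ioi
      refine ((Complex.continuousAt_ofReal_cpow_const _ _ (Or.inr (ne_of_gt ht)))).mul ?_
      fun_prop
    · filter_upwards [ae_restrict_mem measurableSet_Ioi] with t ht y hy
      have ht : 0 < t := ht
      have hy' : z.re / 2 ≤ y.re := by
        have h1 := (Complex.abs_re_le_norm (y - z)).trans (mem_ball_iff_norm.1 hy).le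
        have h2 := (abs_le.1 h1).1
        rw [Complex.sub_re] at h2
        linarith
      rw [norm_mul, norm_mul, Complex.norm_cpow_eq_rpow_re_of_pos ht, Complex.norm_exp, norm_neg,
        Complex.norm_real, Real.norm_of_nonneg ht.le, Real.rpow_one, mul_comm (Real.exp _),
        ← mul_assoc]
      have : t ^ (s - 1).re * t = t ^ s.re := by
        rw [Complex.sub_re, Complex.one_re, Real.rpow_sub_one ht.ne', div_mul_cancel₀ _ ht.ne']
      rw [this]
      gcongr
      simp only [Complex.neg_re, Complex.mul_re, Complex.ofReal_re, Complex.ofReal_im]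
      nlinarith
    · exact integrableOn_rpow_mul_exp_neg_mul_rpow (by linarith) one_pos (half_pos hz)
    · filter_upwards with t y _
      refine HasDerivAt.const_mul _ (HasDerivAt.cexp ?_)
      exact ((hasDerivAt_id y).mul_const (t : ℂ)).neg.congr_deriv (by simp)
  have hR : DifferentiableOn ℂ (fun z : ℂ ↦ z ^ (-s) * Complex.Gamma s) U := by
    intro z hz
    have hz' : z ∈ Complex.slitPlane := Or.inl hz
    exact ((differentiableAt_id.cpow_const hz').mul_const _).differentiableWithinAt
  refine (hL.analyticOnNhd hU).eqOn_of_preconnected_of_frequently_eq (hR.analyticOnNhd hU) hUc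
    (z₀ := 1) (by simp [U]) ?_ hw
  have htend : Filter.Tendsto (fun n : ℕ ↦ ((1 + 1 / ((n : ℝ) + 1) : ℝ) : ℂ)) Filter.atTop
      (nhdsWithin 1 {1}ᶜ) := by
    refine tendsto_nhdsWithin_iff.2 ⟨?_, Filter.Eventually.of_forall fun n ↦ ?_⟩
    · have h := (tendsto_one_div_add_atTop_nhds_zero_nat (𝕜 := ℝ)).const_add 1
      rw [add_zero] at h
      exact_mod_cast (Complex.continuous_ofReal.tendsto 1).comp h
    · have : (0 : ℝ) < 1 / ((n : ℝ) + 1) := by positivity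
      simp only [mem_compl_iff, mem_singleton_iff]
      intro h
      have h := Complex.ofReal_eq_one.1 h
      linarith
  refine htend.frequently (Filter.Frequently.of_forall fun n ↦ ?_)
  have hr : (0 : ℝ) < 1 + 1 / ((n : ℝ) + 1) := by positivity
  rw [Complex.integral_cpow_mul_exp_neg_mul_Ioi hs hr, one_div, Complex.inv_cpow,
    Complex.cpow_neg]
  rw [Complex.arg_ofReal_of_nonneg hr.le]
  exact Real.pi_pos.ne

open MeasureTheory Set in
/-- The Mellin transform of an exponential series with complex rates is a Dirichlet series. -/
theorem hasSum_mellin_of_re_pos {ι : Type*} [Countable ι] {a : ι → ℂ} {p : ι → ℝ} {F : ℝ → ℂ}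
    {s w : ℂ} (hp : ∀ i, 0 < p i) (hs : 0 < s.re) (hw : 0 < w.re)
    (hF : ∀ t ∈ Ioi (0 : ℝ), HasSum (fun i ↦ a i * Complex.exp (-(p i * w * t))) (F t))
    (hsum : Summable fun i ↦ ‖a i‖ / (p i) ^ s.re) :
    HasSum (fun i ↦ w ^ (-s) * Complex.Gamma s * (a i * (p i : ℂ) ^ (-s))) (mellin F s) := by
  have hpw : ∀ i, 0 < ((p i : ℂ) * w).re := fun i ↦ by simpa using mul_pos (hp i) hw
  have hint : ∀ i, IntegrableOn
      (fun t : ℝ ↦ (t : ℂ) ^ (s - 1) * (a i * Complex.exp (-(p i * w * t)))) (Ioi 0) := fun i ↦ by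
    simp_rw [mul_left_comm _ (a i)]
    exact (integrableOn_cpow_mul_exp_neg_mul hs (hpw i)).const_mul (a i)
  have hnorm : ∀ i, ∫ t : ℝ in Ioi 0, ‖(t : ℂ) ^ (s - 1) * (a i * Complex.exp (-(p i * w * t)))‖ =
      Real.Gamma s.re * (1 / w.re) ^ s.re * (‖a i‖ / p i ^ s.re) := fun i ↦ by
    have h := Real.integral_rpow_mul_exp_neg_mul_Ioi hs (mul_pos (hp i) hw)
    rw [Real.div_rpow zero_le_one (mul_pos (hp i) hw).le, Real.mul_rpow (hp i).le hw.le,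
      Real.one_rpow] at h
    calc _ = ∫ t : ℝ in Ioi 0, ‖a i‖ * (t ^ (s.re - 1) * Real.exp (-(p i * w.re * t))) := by
          refine setIntegral_congr_fun measurableSet_Ioi fun t ht ↦ ?_
          simp only [norm_mul, Complex.norm_cpow_eq_rpow_re_of_pos (show 0 < t from ht),
            Complex.norm_exp]
          simp
          ring
      _ = _ := by
          rw [integral_const_mul, h, Real.div_rpow zero_le_one hw.le, Real.one_rpow]
          have := Real.rpow_pos_of_pos (hp i) s.re
          have := Real.rpow_pos_of_pos hw s.re
          field_simp
  have key := hasSum_integral_of_summable_integral_norm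
    (μ := volume.restrict (Ioi (0 : ℝ))) hint (by simp_rw [hnorm]; exact hsum.mul_left _)
  have e₁ : ∀ i, ∫ t : ℝ in Ioi 0, (t : ℂ) ^ (s - 1) * (a i * Complex.exp (-(p i * w * t))) =
      w ^ (-s) * Complex.Gamma s * (a i * (p i : ℂ) ^ (-s)) := fun i ↦ by
    simp_rw [mul_left_comm _ (a i), integral_const_mul]
    rw [integral_cpow_mul_exp_neg_mul_of_re_pos hs (hpw i), cpow_ofReal_mul (hp i)]
    · ring
    · rintro rfl
      simp at hw
  simp_rw [e₁] at key
  have e₂ : mellin F s = ∫ t : ℝ in Ioi 0, ∑' i,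
      (t : ℂ) ^ (s - 1) * (a i * Complex.exp (-(p i * w * t))) := by
    refine setIntegral_congr_fun measurableSet_Ioi fun t ht ↦ ?_
    simp only [smul_eq_mul]
    rw [← (hF t ht).tsum_eq, tsum_mul_left]
  rwa [e₂]

open MeasureTheory Set in
theorem norm_cpow_neg_mul_Gamma_le {s : ℂ} {θ : ℝ} (hs : 0 < s.re) (hθ : |θ| < Real.pi / 2) :
    ‖Complex.exp (-(θ * Complex.I * s)) * Complex.Gamma s‖ ≤
      Real.Gamma s.re * (1 / Real.cos θ) ^ s.re := by
  have hθ' := abs_lt.1 hθ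
  have hcos : 0 < Real.cos θ := Real.cos_pos_of_mem_Ioo ⟨by linarith, by linarith⟩
  have hwre : (Complex.exp (θ * Complex.I)).re = Real.cos θ := Complex.exp_ofReal_mul_I_re θ
  have h := integral_cpow_mul_exp_neg_mul_of_re_pos hs (hwre ▸ hcos)
  have hpow : Complex.exp (θ * Complex.I) ^ (-s) = Complex.exp (-(θ * Complex.I * s)) := by
    rw [Complex.cpow_def_of_ne_zero (Complex.exp_ne_zero _), Complex.log_exp]
    · ring_nf
    · simp; linarith [Real.pi_pos]
    · simp; linarith [Real.pi_pos]
  rw [hpow] at h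
  rw [← h, mul_comm (Real.Gamma _), ← Real.integral_rpow_mul_exp_neg_mul_Ioi hs hcos]
  refine (norm_integral_le_integral_norm _).trans_eq ?_
  refine setIntegral_congr_fun measurableSet_Ioi fun t ht ↦ ?_
  simp only [norm_mul, Complex.norm_cpow_eq_rpow_re_of_pos (show 0 < t from ht), Complex.norm_exp]
  simp [hwre]

theorem norm_Gamma_half_add_mul_I_le (v : ℝ) :
    ‖Complex.Gamma (1 / 2 + v * Complex.I)‖ ≤
      Real.sqrt (2 * Real.pi) * Real.exp (-(Real.pi / 2 * |v|)) := by
  have hrefl := Complex.Gamma_mul_Gamma_one_sub (1 / 2 + v * Complex.I)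
  have hconj : 1 - (1 / 2 + v * Complex.I) = starRingEnd ℂ (1 / 2 + v * Complex.I) := by
    apply Complex.ext <;> norm_num
  have hsin : Complex.sin (Real.pi * (1 / 2 + v * Complex.I)) = (Real.cosh (Real.pi * v) : ℂ) := by
    rw [show (Real.pi : ℂ) * (1 / 2 + v * Complex.I) =
      (Real.pi * v : ℝ) * Complex.I + Real.pi / 2 by push_cast; ring, Complex.sin_add_pi_div_two,
      Complex.cos_mul_I, Complex.ofReal_cosh]
  rw [hconj, Complex.Gamma_conj, hsin, Complex.mul_conj, Complex.normSq_eq_norm_sq] at hrefl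
  have h : ‖Complex.Gamma (1 / 2 + v * Complex.I)‖ ^ 2 = Real.pi / Real.cosh (Real.pi * v) := by
    exact_mod_cast hrefl
  have hcosh : Real.exp (Real.pi * |v|) / 2 ≤ Real.cosh (Real.pi * v) := by
    rw [← Real.cosh_abs (Real.pi * v), abs_mul, abs_of_pos Real.pi_pos, Real.cosh_eq]
    linarith [Real.exp_pos (-(Real.pi * |v|))]
  refine le_of_sq_le_sq ?_ (by positivity)
  rw [h, mul_pow, Real.sq_sqrt (by positivity), ← Real.exp_nat_mul]
  calc _ ≤ Real.pi / (Real.exp (Real.pi * |v|) / 2) := by gcongr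
    _ = _ := by
      rw [show ((2 : ℕ) : ℝ) * -(Real.pi / 2 * |v|) = -(Real.pi * |v|) by push_cast; ring,
        Real.exp_neg]
      field_simp

theorem norm_Gamma_le_of_mem_Icc {σ t : ℝ} (hσ : σ ∈ Set.Icc (1 / 2 : ℝ) (3 / 2)) (ht : 1 ≤ t) :
    ‖Complex.Gamma (σ + t * Complex.I)‖ ≤
      (Real.sqrt (2 * Real.pi) * (2 * Real.exp 1)) * t ^ (σ - 1 / 2) *
        Real.exp (-(Real.pi / 2 * t)) := by
  have ht0 : 0 < t := by linarith
  set θ : ℝ := Real.pi / 2 - 1 / t with hθdef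
  have hit : 1 / t ≤ 1 := (div_le_one ht0).2 ht
  have hit0 : 0 < 1 / t := by positivity
  have hθ0 : 0 < θ := by linarith [Real.pi_gt_three]
  have hθ : |θ| < Real.pi / 2 := by rw [abs_of_pos hθ0]; linarith
  have hcos : 0 < Real.cos θ := by
    refine Real.cos_pos_of_mem_Ioo ⟨?_, ?_⟩ <;> linarith [Real.pi_pos]
  let f : ℂ → ℂ := fun z ↦ Complex.exp (-(θ * Complex.I * z)) * Complex.Gamma z
  have hrot : ∀ z : ℂ, ‖Complex.exp (-(θ * Complex.I * z))‖ = Real.exp (θ * z.im) := fun z ↦ by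
    rw [Complex.norm_exp]
    simp
  have hhalf : ∀ v : ℝ, ‖f (1 / 2 + v * Complex.I)‖ ≤
      Real.sqrt (2 * Real.pi) * Real.exp (-(|v| / t)) := fun v ↦ by
    simp only [f]
    rw [norm_mul, hrot, mul_comm]
    calc _ ≤ (Real.sqrt (2 * Real.pi) * Real.exp (-(Real.pi / 2 * |v|))) *
          Real.exp (θ * |v|) := by
          gcongr
          · exact norm_Gamma_half_add_mul_I_le v
          · simpa using le_abs_self v
      _ = _ := by
          rw [mul_assoc, ← Real.exp_add, hθdef]
          ring_nf
  have hre : ∀ {z : ℂ} {r : ℝ}, z.re = r → z = r + z.im * Complex.I := fun h ↦ by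
    rw [← h, Complex.re_add_im]
  have hpos : ∀ z ∈ Complex.HadamardThreeLines.verticalClosedStrip (1 / 2) (3 / 2),
      0 < z.re := fun z hz ↦ by
    have : z.re ∈ Set.Icc (1 / 2 : ℝ) (3 / 2) := hz
    linarith [this.1]
  have hdiff : ∀ z ∈ Complex.HadamardThreeLines.verticalClosedStrip (1 / 2) (3 / 2),
      DifferentiableAt ℂ f z := fun z hz ↦ by
    refine DifferentiableAt.mul (by fun_prop) (Complex.differentiableAt_Gamma z fun m h ↦ ?_)
    have := hpos z hz
    rw [h] at this
    simp at this
    linarith [Nat.cast_nonneg (α := ℝ) m]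
  have key := Complex.HadamardThreeLines.norm_le_interp_of_mem_verticalClosedStrip'
    (f := f) (z := σ + t * Complex.I) (a := Real.sqrt (2 * Real.pi))
    (b := Real.sqrt (2 * Real.pi) * (2 * t)) (l := 1 / 2) (u := 3 / 2) (by norm_num)
    (by simpa [Complex.HadamardThreeLines.verticalClosedStrip] using hσ)
    (by
      refine DifferentiableOn.diffContOnCl fun z hz ↦ (hdiff z ?_).differentiableWithinAt
      have hsub : closure (Complex.HadamardThreeLines.verticalStrip (1 / 2) (3 / 2)) ⊆
          Complex.HadamardThreeLines.verticalClosedStrip (1 / 2) (3 / 2) :=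
        closure_minimal (fun w hw ↦ Set.Ioo_subset_Icc_self hw)
          (isClosed_Icc.preimage Complex.continuous_re)
      exact hsub hz)
    (by
      have hcont : ContinuousOn (fun x : ℝ ↦ Real.Gamma x * (1 / Real.cos θ) ^ x)
          (Set.Icc (1 / 2) (3 / 2)) := by
        intro x hx
        have hx0 : 0 < x := by linarith [hx.1]
        refine ContinuousAt.continuousWithinAt (ContinuousAt.mul ?_ ?_)
        · refine (Real.differentiableAt_Gamma fun m h ↦ ?_).continuousAt
          linarith [Nat.cast_nonneg (α := ℝ) m]
        · exact Real.continuousAt_const_rpow (by positivity)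
      obtain ⟨B, hB⟩ := isCompact_Icc.bddAbove_image hcont
      refine ⟨B, ?_⟩
      rintro _ ⟨z, hz, rfl⟩
      exact (norm_cpow_neg_mul_Gamma_le (hpos z hz) hθ).trans (hB ⟨z.re, hz, rfl⟩))
    (by
      intro z hz
      rw [hre (r := 1 / 2) hz]
      have := hhalf z.im
      push_cast
      refine this.trans (mul_le_of_le_one_right (by positivity) (Real.exp_le_one_iff.2 ?_))
      have := abs_nonneg z.im
      have : 0 ≤ |z.im| / t := by positivity
      linarith)
    (by
      intro z hz
      rw [hre (r := 3 / 2) hz]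
      set v := z.im
      have hne : (1 / 2 + v * Complex.I : ℂ) ≠ 0 := fun h ↦ by
        have := congrArg Complex.re h
        norm_num at this
      have h1 : f ((3 / 2 : ℝ) + v * Complex.I) = Complex.exp (-(θ * Complex.I)) *
          (1 / 2 + v * Complex.I) * f (1 / 2 + v * Complex.I) := by
        simp only [f]
        rw [show ((3 / 2 : ℝ) + v * Complex.I : ℂ) = (1 / 2 + v * Complex.I) + 1 by
          push_cast; ring, Complex.Gamma_add_one _ hne, mul_add, neg_add, Complex.exp_add, mul_one]
        ring
      have h2 : ‖Complex.exp (-(θ * Complex.I))‖ = 1 := by simpa using hrot 1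
      have h3 : ‖(1 / 2 + v * Complex.I : ℂ)‖ ≤ 1 / 2 + |v| := by
        refine (norm_add_le _ _).trans ?_
        simp
      have hy : |v| / t ≤ Real.exp (|v| / t) := by
        linarith [Real.add_one_le_exp (|v| / t)]
      rw [h1, norm_mul, norm_mul, h2, one_mul]
      calc _ ≤ (1 / 2 + |v|) * (Real.sqrt (2 * Real.pi) * Real.exp (-(|v| / t))) := by
            gcongr
            exact hhalf v
        _ = Real.sqrt (2 * Real.pi) * (1 / 2 * Real.exp (-(|v| / t)) +
              t * (|v| / t * Real.exp (-(|v| / t)))) := by field_simp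
        _ ≤ Real.sqrt (2 * Real.pi) * (1 / 2 * 1 + t * 1) := by
            have e1 : Real.exp (-(|v| / t)) ≤ 1 := Real.exp_le_one_iff.2 (by
              have : 0 ≤ |v| / t := by positivity
              linarith)
            have e2 : |v| / t * Real.exp (-(|v| / t)) ≤ 1 := by
              rw [Real.exp_neg, ← div_eq_mul_inv, div_le_one (Real.exp_pos _)]
              exact hy
            gcongr
        _ ≤ _ := by gcongr; linarith)
  have hre' : ((σ : ℂ) + t * Complex.I).re = σ := by simp
  have him' : ((σ : ℂ) + t * Complex.I).im = t := by simp
  simp only [f] at key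
  rw [norm_mul, hrot, hre', him', show (3 / 2 : ℝ) - 1 / 2 = 1 by norm_num, div_one,
    Real.mul_rpow (by positivity) (by positivity), ← mul_assoc,
    ← Real.rpow_add (by positivity), sub_add_cancel, Real.rpow_one,
    Real.mul_rpow (by norm_num) ht0.le] at key
  have h2 : (2 : ℝ) ^ (σ - 1 / 2) ≤ 2 := by
    calc (2 : ℝ) ^ (σ - 1 / 2) ≤ 2 ^ (1 : ℝ) :=
        Real.rpow_le_rpow_of_exponent_le (by norm_num) (by linarith [hσ.2])
      _ = 2 := by norm_num
  have hexp : Real.exp (θ * t) = Real.exp (Real.pi / 2 * t) / Real.exp 1 := by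
    rw [← Real.exp_sub, hθdef, sub_mul, one_div_mul_cancel ht0.ne']
  rw [hexp] at key
  have hE := Real.exp_pos (Real.pi / 2 * t)
  have h1 := Real.exp_pos 1
  rw [Real.exp_neg, ← div_eq_mul_inv, le_div_iff₀ hE]
  calc _ = Real.exp 1 * (Real.exp (Real.pi / 2 * t) / Real.exp 1 *
        ‖Complex.Gamma (σ + t * Complex.I)‖) := by field_simp
    _ ≤ Real.exp 1 * (Real.sqrt (2 * Real.pi) * (2 * t ^ (σ - 1 / 2))) := by
      refine mul_le_mul_of_nonneg_left (key.trans ?_) h1.le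
      gcongr
    _ = _ := by ring

/-- A uniform lower bound of Stirling type for the Gamma function on vertical lines. -/
theorem exists_le_norm_Gamma : ∃ c > (0 : ℝ), ∀ σ t : ℝ, 1 / 2 ≤ σ → 1 ≤ t →
    c * t ^ (σ - 1 / 2) * Real.exp (-(Real.pi / 2 * t)) ≤
      ‖Complex.Gamma (σ + t * Complex.I)‖ := by
  set K : ℝ := Real.sqrt (2 * Real.pi) * (2 * Real.exp 1) with hK
  have hK0 : 0 < K := by positivity
  refine ⟨Real.pi / K, by positivity, ?_⟩
  suffices h : ∀ n : ℕ, ∀ σ t : ℝ, 1 / 2 ≤ σ → σ ≤ n + 3 / 2 → 1 ≤ t →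
      Real.pi / K * t ^ (σ - 1 / 2) * Real.exp (-(Real.pi / 2 * t)) ≤
        ‖Complex.Gamma (σ + t * Complex.I)‖ by
    intro σ t hσ ht
    obtain ⟨n, hn⟩ := exists_nat_ge σ
    exact h n σ t hσ (by linarith) ht
  intro n
  induction n with
  | zero =>
    intro σ t hσ hσ' ht
    have ht0 : 0 < t := by linarith
    set s : ℂ := σ + t * Complex.I with hs
    have hne : 1 - s ≠ 0 := fun h ↦ by
      have := congrArg Complex.im h
      simp [hs] at this
      linarith
    have hrefl := Complex.Gamma_mul_Gamma_one_sub s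
    have hshift := Complex.Gamma_add_one _ hne
    have hconj : (1 - s) + 1 = starRingEnd ℂ (((2 - σ : ℝ) : ℂ) + t * Complex.I) := by
      apply Complex.ext <;> simp [hs]
      ring
    rw [hconj, Complex.Gamma_conj] at hshift
    have hub := norm_Gamma_le_of_mem_Icc (σ := 2 - σ) (t := t)
      ⟨by norm_num at hσ'; linarith, by linarith⟩ ht
    have hsin : ‖Complex.sin (Real.pi * s)‖ ≤ Real.exp (Real.pi * t) := by
      rw [Complex.sin]
      have e1 : ‖Complex.exp (-(Real.pi * s) * Complex.I)‖ = Real.exp (Real.pi * t) := by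
        rw [Complex.norm_exp]; simp [hs]
      have e2 : ‖Complex.exp (Real.pi * s * Complex.I)‖ ≤ Real.exp (Real.pi * t) := by
        rw [Complex.norm_exp]; simp [hs]; nlinarith [Real.pi_pos]
      rw [norm_div, norm_mul, Complex.norm_I, mul_one, Complex.norm_ofNat, div_le_iff₀ two_pos]
      refine (norm_sub_le _ _).trans ?_
      linarith
    have h1s : t ≤ ‖1 - s‖ := by
      refine le_trans ?_ (Complex.abs_im_le_norm _)
      simp [hs, abs_of_pos ht0]
    have hprod : ‖Complex.Gamma s‖ * ‖Complex.Gamma (((2 - σ : ℝ) : ℂ) + t * Complex.I)‖ *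
        ‖Complex.sin (Real.pi * s)‖ = ‖1 - s‖ * Real.pi := by
      have hn : ‖Complex.Gamma (((2 - σ : ℝ) : ℂ) + t * Complex.I)‖ =
          ‖1 - s‖ * ‖Complex.Gamma (1 - s)‖ := by
        rw [← norm_mul, ← hshift, RCLike.norm_conj]
      have hs0 : Complex.sin (Real.pi * s) ≠ 0 := by
        intro h0
        rw [Complex.sin_eq_zero_iff] at h0
        obtain ⟨m, hm⟩ := h0
        have := congrArg Complex.im hm
        simp [hs] at this
        linarith
      rw [hn]
      have := congrArg norm hrefl
      rw [norm_mul, norm_div, eq_div_iff (norm_ne_zero_iff.2 hs0), Complex.norm_real,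
        Real.norm_of_nonneg Real.pi_pos.le] at this
      linear_combination ‖1 - s‖ * this
    have hlow : t * Real.pi ≤ ‖Complex.Gamma s‖ * (K * t ^ (2 - σ - 1 / 2) *
        Real.exp (-(Real.pi / 2 * t))) * Real.exp (Real.pi * t) := by
      calc t * Real.pi ≤ ‖1 - s‖ * Real.pi := by gcongr
        _ = _ := hprod.symm
        _ ≤ _ := by gcongr
    have hpow : t ^ (σ - 1 / 2) * t ^ (2 - σ - 1 / 2) = t := by
      rw [← Real.rpow_add ht0]
      ring_nf
      exact Real.rpow_one t
    have hexp : Real.exp (Real.pi * t) =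
        Real.exp (Real.pi / 2 * t) * Real.exp (Real.pi / 2 * t) := by
      rw [← Real.exp_add]; ring_nf
    have hE := Real.exp_pos (Real.pi / 2 * t)
    rw [hexp, Real.exp_neg] at hlow
    rw [Real.exp_neg]
    have hp := Real.rpow_pos_of_pos ht0 (2 - σ - 1 / 2)
    rw [← mul_le_mul_iff_left₀ (mul_pos (mul_pos hK0 hp) hE)]
    calc _ = (t ^ (σ - 1 / 2) * t ^ (2 - σ - 1 / 2)) * Real.pi := by field_simp
      _ = t * Real.pi := by rw [hpow]
      _ ≤ _ := hlow
      _ = _ := by field_simp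
  | succ n ih =>
    intro σ t hσ hσ' ht
    have ht0 : 0 < t := by linarith
    rcases le_or_gt σ (n + 3 / 2) with h | h
    · exact ih σ t hσ h ht
    push_cast at hσ'
    have h0 := ih (σ - 1) t (by linarith [Nat.cast_nonneg (α := ℝ) n]) (by linarith) ht
    set s : ℂ := ((σ - 1 : ℝ) : ℂ) + t * Complex.I with hs
    have hts : t ≤ ‖s‖ := by
      refine le_trans ?_ (Complex.abs_im_le_norm _)
      simp [hs, abs_of_pos ht0]
    have hs0 : s ≠ 0 := norm_pos_iff.1 (ht0.trans_le hts)
    have hsucc : (σ + t * Complex.I : ℂ) = s + 1 := by rw [hs]; push_cast; ring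
    rw [hsucc, Complex.Gamma_add_one _ hs0, norm_mul]
    calc _ = t * (Real.pi / K * t ^ (σ - 1 - 1 / 2) * Real.exp (-(Real.pi / 2 * t))) := by
          rw [show σ - 1 / 2 = (σ - 1 - 1 / 2) + 1 by ring, Real.rpow_add_one ht0.ne']
          ring
      _ ≤ _ := by gcongr

open MeasureTheory Set in
theorem integrable_exp_neg_mul_abs {p : ℝ} (hp : 0 < p) :
    Integrable fun x : ℝ ↦ Real.exp (-(p * |x|)) := by
  have hpos : IntegrableOn (fun x : ℝ ↦ Real.exp (-(p * |x|))) (Ioi 0) := by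
    refine (integrableOn_exp_mul_Ioi (neg_neg_of_pos hp) 0).congr_fun (fun x hx ↦ ?_)
      measurableSet_Ioi
    simp [abs_of_pos (show 0 < x from hx)]
  have hneg : IntegrableOn (fun x : ℝ ↦ Real.exp (-(p * |x|))) (Iic 0) := by
    refine (integrableOn_exp_mul_Iic hp 0).congr_fun (fun x hx ↦ ?_) measurableSet_Iic
    simp [abs_of_nonpos (show x ≤ 0 from hx)]
  simpa [Iic_union_Ioi] using hneg.union hpos

open MeasureTheory Set in
theorem integral_exp_neg_mul_abs {p : ℝ} (hp : 0 < p) :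
    ∫ x : ℝ, Real.exp (-(p * |x|)) = 2 / p := by
  rw [integral_comp_abs (f := fun x ↦ Real.exp (-(p * x)))]
  simp_rw [← neg_mul]
  rw [integral_exp_mul_Ioi (neg_neg_of_pos hp)]
  simp
  field_simp

open MeasureTheory in
theorem integral_norm_sq_le_of_norm_le_exp {g : ℝ → ℂ} (hg : Continuous g) {A p u₀ : ℝ}
    (hp : 0 < p) (h : ∀ u, ‖g u‖ ≤ A * Real.exp (-(p * |u - u₀|))) :
    Integrable g ∧ MemLp g 2 ∧ ∫ u, ‖g u‖ ^ 2 ≤ A ^ 2 / p := by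
  have h₁ : Integrable g :=
    (((integrable_exp_neg_mul_abs hp).comp_sub_right u₀).const_mul A).mono'
      hg.aestronglyMeasurable (.of_forall h)
  have hint := ((integrable_exp_neg_mul_abs (mul_pos two_pos hp)).comp_sub_right u₀).const_mul
    (A ^ 2)
  have hsq : ∀ u, ‖g u‖ ^ 2 ≤ A ^ 2 * Real.exp (-(2 * p * |u - u₀|)) := fun u ↦ by
    refine (pow_le_pow_left₀ (norm_nonneg _) (h u) 2).trans_eq ?_
    rw [mul_pow, ← Real.exp_nat_mul]
    push_cast
    ring_nf
  have h₂ : Integrable fun u ↦ ‖g u‖ ^ 2 :=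
    hint.mono' (by fun_prop) (.of_forall fun u ↦ by simpa using hsq u)
  refine ⟨h₁, (memLp_two_iff_integrable_sq_norm hg.aestronglyMeasurable).2 h₂, ?_⟩
  calc _ ≤ ∫ u, A ^ 2 * Real.exp (-(2 * p * |u - u₀|)) := integral_mono h₂ hint hsq
    _ = _ := by
      rw [integral_const_mul, integral_sub_right_eq_self fun u ↦ Real.exp (-(2 * p * |u|)),
        integral_exp_neg_mul_abs (mul_pos two_pos hp)]
      field_simp

open MeasureTheory FourierTransform in
/-- A mean value estimate for short averages of a Fourier transform. -/
theorem integral_norm_sq_intervalIntegral_fourier_le {g : ℝ → ℂ} (hg : Continuous g)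
    (h₁ : Integrable g) {A H : ℝ} (hA : ∀ u, ‖g u‖ ≤ A) (hH : 0 < H) :
    Integrable (fun ξ : ℝ ↦ ‖∫ u in (0 : ℝ)..H, 𝓕 g (ξ + u / (2 * Real.pi))‖ ^ 2) ∧
      ∫ ξ : ℝ, ‖∫ u in (0 : ℝ)..H, 𝓕 g (ξ + u / (2 * Real.pi))‖ ^ 2 ≤
        A ^ 2 * (4 * Real.pi * H) := by
  have hA0 : 0 ≤ A := (norm_nonneg _).trans (hA 0)
  let K : ℝ → ℂ := fun x ↦ ∫ u in (0 : ℝ)..H, Complex.exp ((-(x * u) : ℝ) * Complex.I)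
  have hKc : Continuous K :=
    intervalIntegral.continuous_parametric_intervalIntegral_of_continuous' (by fun_prop) _ _
  have hKH : ∀ x, ‖K x‖ ≤ H := fun x ↦ by
    have := intervalIntegral.norm_integral_le_of_norm_le_const (a := 0) (b := H) (C := 1)
      (f := fun u : ℝ ↦ Complex.exp ((-(x * u) : ℝ) * Complex.I))
      fun u _ ↦ (Complex.norm_exp_ofReal_mul_I _).le
    rwa [sub_zero, abs_of_pos hH, one_mul] at this
  have hKx : ∀ x, ‖K x‖ * |x| ≤ 2 := fun x ↦ by
    rcases eq_or_ne x 0 with rfl | hx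
    · simp
    have hc : -(x : ℂ) * Complex.I ≠ 0 := by simp [hx]
    have : K x = (Complex.exp (-(x : ℂ) * Complex.I * H) -
        Complex.exp (-(x : ℂ) * Complex.I * (0 : ℝ))) / (-(x : ℂ) * Complex.I) := by
      rw [← integral_exp_mul_complex hc]
      simp only [K]
      congr with u
      push_cast
      ring_nf
    rw [this, norm_div]
    simp only [norm_mul, norm_neg, Complex.norm_real, Complex.norm_I, mul_one, Real.norm_eq_abs]
    rw [div_mul_cancel₀ _ (abs_ne_zero.2 hx)]
    refine (norm_sub_le _ _).trans ?_
    simp only [Complex.norm_exp]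
    simp
    norm_num
  have hKsq : ∀ x, ‖K x‖ ^ 2 ≤ 2 * H ^ 2 * (1 + (H / 2 * x) ^ 2)⁻¹ := fun x ↦ by
    rw [← div_eq_mul_inv, le_div_iff₀ (by positivity)]
    have e₁ : (‖K x‖ * |x|) ^ 2 ≤ 2 ^ 2 := pow_le_pow_left₀ (by positivity) (hKx x) 2
    have e₂ : ‖K x‖ ^ 2 ≤ H ^ 2 := pow_le_pow_left₀ (by positivity) (hKH x) 2
    rw [mul_pow, sq_abs] at e₁
    nlinarith [mul_le_mul_of_nonneg_left e₁ (sq_nonneg H)]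
  have hFub : ∀ ξ : ℝ, ∫ u in (0 : ℝ)..H, 𝓕 g (ξ + u / (2 * Real.pi)) =
      𝓕 (fun x ↦ K x * g x) ξ := fun ξ ↦ by
    simp_rw [Real.fourier_real_eq_integral_exp_smul, intervalIntegral.integral_of_le hH.le]
    rw [integral_integral_swap]
    · congr with x
      simp only [smul_eq_mul, K, intervalIntegral.integral_of_le hH.le]
      rw [← mul_assoc, ← integral_const_mul, ← integral_mul_const]
      congr with u
      rw [← Complex.exp_add]
      congr 2
      push_cast
      field_simp
      ring
    · have : Integrable (fun z : ℝ × ℝ ↦ (1 : ℝ) * ‖g z.2‖)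
          ((volume.restrict (Set.Ioc 0 H)).prod volume) :=
        Integrable.mul_prod (integrable_const (1 : ℝ)) h₁.norm
      refine this.mono' ?_ (.of_forall fun z ↦ ?_)
      · refine Continuous.aestronglyMeasurable ?_
        simp only [Function.uncurry_def, smul_eq_mul]
        fun_prop
      · simp only [Function.uncurry_def, norm_smul, Complex.norm_exp_ofReal_mul_I]
        rfl
  have hKg₁ : Integrable fun x ↦ K x * g x :=
    h₁.bdd_mul hKc.aestronglyMeasurable (.of_forall hKH)
  have hI : Integrable fun x : ℝ ↦ A ^ 2 * (2 * H ^ 2 * (1 + (H / 2 * x) ^ 2)⁻¹) :=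
    ((integrable_inv_one_add_sq.comp_mul_left' (half_pos hH).ne').const_mul _).const_mul _
  have hbd : ∀ x, ‖K x * g x‖ ^ 2 ≤ A ^ 2 * (2 * H ^ 2 * (1 + (H / 2 * x) ^ 2)⁻¹) := fun x ↦ by
    rw [norm_mul, mul_pow, mul_comm]
    gcongr
    · exact hA x
    · exact hKsq x
  have hKg : Continuous fun x ↦ K x * g x := hKc.mul hg
  have hsq : Integrable fun x ↦ ‖K x * g x‖ ^ 2 :=
    hI.mono' (by fun_prop) (.of_forall fun x ↦ by simpa using hbd x)
  obtain ⟨i₁, i₂⟩ := integral_norm_sq_fourier hKg₁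
    ((memLp_two_iff_integrable_sq_norm hKg.aestronglyMeasurable).2 hsq)
  simp_rw [hFub]
  refine ⟨i₁, i₂.trans_le ((integral_mono hsq hI hbd).trans_eq ?_)⟩
  rw [integral_const_mul, integral_const_mul,
    Measure.integral_comp_mul_left (fun x : ℝ ↦ (1 + x ^ 2)⁻¹), integral_univ_inv_one_add_sq,
    abs_of_pos (by positivity), smul_eq_mul]
  field_simp
  ring

theorem exists_rpow_mul_exp_neg_le {κ : ℝ} (P : ℝ) (hκ : 0 < κ) :
    ∃ K > (0 : ℝ), ∀ p v : ℝ, 0 ≤ p → p ≤ P → 0 < v →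
      v ^ p * Real.exp (-(κ * v)) ≤ K * Real.exp (-(p * |Real.log v|)) := by
  set n := ⌈2 * P⌉₊
  refine ⟨max 1 (n.factorial / κ ^ n), by positivity, fun p v hp hpP hv ↦ ?_⟩
  rcases le_total v 1 with h | h
  · rw [abs_of_nonpos (Real.log_nonpos hv.le h), Real.rpow_def_of_pos hv]
    have : Real.exp (-(p * -Real.log v)) = Real.exp (Real.log v * p) := by ring_nf
    rw [this, mul_comm]
    gcongr
    refine le_max_of_le_left (Real.exp_le_one_iff.2 ?_)
    have := mul_pos hκ hv
    linarith
  · rw [abs_of_nonneg (Real.log_nonneg h)]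
    have h₁ : Real.exp (-(p * Real.log v)) = v ^ (-p) := by
      rw [Real.rpow_def_of_pos hv]
      ring_nf
    have h₂ : v ^ p * v ^ p ≤ v ^ n := by
      rw [← Real.rpow_add hv, ← Real.rpow_natCast]
      refine Real.rpow_le_rpow_of_exponent_le h ?_
      linarith [Nat.le_ceil (2 * P)]
    have h₃ := Real.pow_div_factorial_le_exp (κ * v) (mul_pos hκ hv).le n
    rw [h₁, Real.rpow_neg hv.le, ← div_eq_mul_inv, le_div_iff₀ (Real.rpow_pos_of_pos hv p),
      Real.exp_neg, mul_right_comm, ← div_eq_mul_inv, div_le_iff₀ (Real.exp_pos _)]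
    rw [div_le_iff₀ (by positivity), mul_pow] at h₃
    calc _ ≤ v ^ n := h₂
      _ ≤ n.factorial / κ ^ n * Real.exp (κ * v) := by
        rw [div_mul_eq_mul_div, le_div_iff₀ (by positivity)]
        linarith
      _ ≤ _ := by gcongr; exact le_max_right _ _

/-- The exponential series `∑ b n exp (-(n + 1) q w)`, indexed from `0`. -/
noncomputable def expSeries (b : ℕ → ℝ) (q : ℝ) (w : ℂ) : ℂ :=
  ∑' n : ℕ, (b n : ℂ) * Complex.exp (-((n + 1) * q * w))

section ExpSeries

variable {b : ℕ → ℝ} {C β q : ℝ}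

theorem summable_abs_mul_exp_neg (hb : ∀ n, |b n| ≤ C * ((n : ℝ) + 1) ^ β) {y : ℝ} (hy : 0 < y) :
    Summable fun n : ℕ ↦ |b n| * Real.exp (-((n + 1) * y)) := by
  have hs := ((summable_nat_add_iff 1).2
    (Real.summable_pow_mul_exp_neg_nat_mul ⌈β⌉₊ hy)).mul_left C
  refine hs.of_nonneg_of_le (fun n ↦ by positivity) fun n ↦ ?_
  have hC : 0 ≤ C := by simpa using (abs_nonneg _).trans (hb 0)
  rw [← mul_assoc]
  have h1 : (1 : ℝ) ≤ n + 1 := by linarith [Nat.cast_nonneg (α := ℝ) n]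
  have e : Real.exp (-((n + 1) * y)) = Real.exp (-y * ((n + 1 : ℕ) : ℝ)) := by
    push_cast
    ring_nf
  rw [e]
  refine mul_le_mul_of_nonneg_right ((hb n).trans ?_) (Real.exp_pos _).le
  refine mul_le_mul_of_nonneg_left ?_ hC
  rw [← Real.rpow_natCast]
  push_cast
  exact Real.rpow_le_rpow_of_exponent_le h1 (Nat.le_ceil β)

theorem norm_expSeries_term (n : ℕ) (w : ℂ) :
    ‖(b n : ℂ) * Complex.exp (-((n + 1) * q * w))‖ =
      |b n| * Real.exp (-((n + 1) * (q * w.re))) := by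
  have : (-(((n : ℂ) + 1) * q * w)).re = -((n + 1) * (q * w.re)) := by
    rw [show (-(((n : ℂ) + 1) * q * w)) = ((-((n + 1) * q) : ℝ) : ℂ) * w by push_cast; ring,
      Complex.re_ofReal_mul]
    ring
  rw [norm_mul, Complex.norm_exp, Complex.norm_real, Real.norm_eq_abs, this]

theorem hasSum_expSeries (hb : ∀ n, |b n| ≤ C * ((n : ℝ) + 1) ^ β) (hq : 0 < q) {w : ℂ}
    (hw : 0 < w.re) :
    HasSum (fun n : ℕ ↦ (b n : ℂ) * Complex.exp (-((n + 1) * q * w))) (expSeries b q w) := by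
  refine Summable.hasSum (Summable.of_norm ?_)
  simp_rw [norm_expSeries_term]
  exact summable_abs_mul_exp_neg hb (mul_pos hq hw)

theorem continuousOn_expSeries (hb : ∀ n, |b n| ≤ C * ((n : ℝ) + 1) ^ β) (hq : 0 < q) :
    ContinuousOn (expSeries b q) {w | 0 < w.re} := by
  intro w hw
  have hw : 0 < w.re := hw
  have hU : {z : ℂ | w.re / 2 < z.re} ∈ nhds w :=
    (isOpen_lt continuous_const Complex.continuous_re).mem_nhds (by simp; linarith)
  refine ContinuousAt.continuousWithinAt (ContinuousOn.continuousAt (s := {z : ℂ | w.re / 2 < z.re})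
    (continuousOn_tsum (fun n ↦ by fun_prop)
      (summable_abs_mul_exp_neg hb (mul_pos hq (half_pos hw))) fun n z hz ↦ ?_) hU)
  have hz : w.re / 2 < z.re := hz
  rw [norm_expSeries_term]
  gcongr

variable {σ₀ A : ℝ}

theorem exists_norm_expSeries_le (hb : ∀ n, |b n| ≤ C * ((n : ℝ) + 1) ^ β) (hq : 0 < q)
    (hσ₀ : 0 ≤ σ₀) (hF : ∀ w : ℂ, 0 < w.re → ‖expSeries b q w‖ ≤ A * w.re ^ (-σ₀)) :
    ∃ M > (0 : ℝ), ∀ w : ℂ, 0 < w.re →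
      ‖expSeries b q w‖ ≤ M * w.re ^ (-σ₀) * Real.exp (-(q / 4 * w.re)) := by
  have hq4 : 0 < q / 4 := by positivity
  obtain ⟨K, hK0, hK⟩ := exists_rpow_mul_exp_neg_le σ₀ hq4
  set S := ∑' n : ℕ, |b n| * Real.exp (-((n + 1) * (q / 2)))
  have hS0 : 0 ≤ S := tsum_nonneg fun n ↦ by positivity
  refine ⟨max 1 (max (A * Real.exp (q / 4)) (S * K)), by positivity, fun w hw ↦ ?_⟩
  have hp := Real.rpow_pos_of_pos hw (-σ₀)
  set y := w.re
  rcases le_total y 1 with h | h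
  · refine (hF w hw).trans ?_
    calc _ = A * 1 * y ^ (-σ₀) := by ring
      _ ≤ A * (Real.exp (q / 4) * Real.exp (-(q / 4 * y))) * y ^ (-σ₀) := by
        have hA : 0 ≤ A := by
          by_contra! hA
          have h1 := (norm_nonneg _).trans (hF 1 (by simp))
          simp at h1
          linarith
        rw [← Real.exp_add]
        gcongr
        refine Real.one_le_exp ?_
        nlinarith
      _ = (A * Real.exp (q / 4)) * y ^ (-σ₀) * Real.exp (-(q / 4 * y)) := by ring
      _ ≤ _ := by
        gcongr
        exact le_max_of_le_right (le_max_left _ _)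
  · have hsum₁ := summable_abs_mul_exp_neg hb (mul_pos hq hw)
    have hsum₂ := (summable_abs_mul_exp_neg hb (half_pos hq)).mul_left (Real.exp (-(q / 2 * y)))
    have h₁ : ‖expSeries b q w‖ ≤ Real.exp (-(q / 2 * y)) * S := by
      rw [← tsum_mul_left]
      refine (norm_tsum_le_tsum_norm (by simpa only [norm_expSeries_term] using hsum₁)).trans ?_
      simp only [norm_expSeries_term]
      refine hsum₁.tsum_le_tsum (fun n ↦ ?_) hsum₂
      rw [mul_left_comm (Real.exp _), ← Real.exp_add]
      refine mul_le_mul_of_nonneg_left (Real.exp_le_exp.2 ?_) (abs_nonneg _)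
      have hn : (0 : ℝ) ≤ n := Nat.cast_nonneg n
      have hd : 0 ≤ (y - 1) * (n + 1) + n * y := by
        have : 0 ≤ y - 1 := by linarith
        positivity
      nlinarith
    have h₂ := hK σ₀ y hσ₀ le_rfl hw
    have h₃ : Real.exp (-(q / 4 * y)) ≤ K * y ^ (-σ₀) := by
      rw [Real.rpow_neg hw.le, ← div_eq_mul_inv, le_div_iff₀ (Real.rpow_pos_of_pos hw _), mul_comm]
      refine h₂.trans (mul_le_of_le_one_right hK0.le (Real.exp_le_one_iff.2 ?_))
      have : 0 ≤ σ₀ * |Real.log y| := by positivity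
      linarith
    have h₄ : Real.exp (-(q / 2 * y)) = Real.exp (-(q / 4 * y)) * Real.exp (-(q / 4 * y)) := by
      rw [← Real.exp_add]
      ring_nf
    calc _ ≤ Real.exp (-(q / 4 * y)) * Real.exp (-(q / 4 * y)) * S := h₄ ▸ h₁
      _ ≤ K * y ^ (-σ₀) * Real.exp (-(q / 4 * y)) * S := by gcongr
      _ = S * K * y ^ (-σ₀) * Real.exp (-(q / 4 * y)) := by ring
      _ ≤ _ := by
        gcongr
        exact le_max_of_le_right (le_max_right _ _)

theorem re_ofReal_mul_exp_mul_I (x θ : ℝ) :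
    ((x : ℂ) * Complex.exp (θ * Complex.I)).re = x * Real.cos θ := by
  rw [Complex.re_ofReal_mul, Complex.exp_ofReal_mul_I_re]

/-- The integrand, in logarithmic coordinates, of the Mellin transform along a rotated ray. -/
noncomputable def rotatedKernel (b : ℕ → ℝ) (q θ σ u : ℝ) : ℂ :=
  Real.exp (-σ * u) • expSeries b q ((Real.exp (-u) : ℝ) * Complex.exp (θ * Complex.I))

theorem continuous_rotatedKernel (hb : ∀ n, |b n| ≤ C * ((n : ℝ) + 1) ^ β) (hq : 0 < q)
    {θ : ℝ} (hθ : 0 < Real.cos θ) (σ : ℝ) : Continuous (rotatedKernel b q θ σ) := by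
  refine Continuous.smul (f := fun u ↦ Real.exp (-σ * u)) (by fun_prop) ?_
  refine (continuousOn_expSeries hb hq).comp_continuous (by fun_prop) fun u ↦ ?_
  simp only [Set.mem_ofPred_eq, re_ofReal_mul_exp_mul_I]
  positivity

theorem exists_norm_rotatedKernel_le (hb : ∀ n, |b n| ≤ C * ((n : ℝ) + 1) ^ β) (hq : 0 < q)
    (hσ₀ : 0 ≤ σ₀) (hF : ∀ w : ℂ, 0 < w.re → ‖expSeries b q w‖ ≤ A * w.re ^ (-σ₀))
    (c : ℝ) :
    ∃ K > (0 : ℝ), ∀ θ σ u : ℝ, 0 < Real.cos θ → σ₀ ≤ σ → σ ≤ c →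
      ‖rotatedKernel b q θ σ u‖ ≤
        K * Real.cos θ ^ (-σ) * Real.exp (-((σ - σ₀) * |u - Real.log (Real.cos θ)|)) := by
  obtain ⟨M, hM0, hM⟩ := exists_norm_expSeries_le hb hq hσ₀ hF
  obtain ⟨K, hK0, hK⟩ := exists_rpow_mul_exp_neg_le (c - σ₀) (by positivity : 0 < q / 4)
  refine ⟨M * K, by positivity, fun θ σ u hθ hσ hσc ↦ ?_⟩
  set η := Real.cos θ
  have hre := re_ofReal_mul_exp_mul_I (Real.exp (-u)) θ
  set v := Real.exp (-u) * η with hv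
  have hv0 : 0 < v := by positivity
  have h₁ := hM _ (hre ▸ hv0 : 0 < ((Real.exp (-u) : ℂ) * Complex.exp (θ * Complex.I)).re)
  rw [hre] at h₁
  have h₂ := hK (σ - σ₀) v (sub_nonneg.2 hσ) (by linarith) hv0
  have hlog : |Real.log v| = |u - Real.log η| := by
    rw [hv, Real.log_mul (Real.exp_pos _).ne' hθ.ne', Real.log_exp, abs_sub_comm]
    ring_nf
  rw [hlog] at h₂
  have hexp : Real.exp (-σ * u) = v ^ σ * η ^ (-σ) := by
    rw [hv, Real.mul_rpow (Real.exp_pos _).le hθ.le, ← Real.exp_mul, mul_assoc, ← Real.rpow_add hθ]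
    simp [mul_comm]
  rw [rotatedKernel, norm_smul, Real.norm_of_nonneg (Real.exp_pos _).le, hexp]
  calc _ ≤ v ^ σ * η ^ (-σ) * (M * v ^ (-σ₀) * Real.exp (-(q / 4 * v))) := by gcongr
    _ = M * η ^ (-σ) * (v ^ (σ - σ₀) * Real.exp (-(q / 4 * v))) := by
      rw [sub_eq_add_neg, Real.rpow_add hv0]
      ring
    _ ≤ M * η ^ (-σ) * (K * Real.exp (-((σ - σ₀) * |u - Real.log η|))) := by gcongr
    _ = _ := by ring

variable {Λ : ℂ → ℂ}

theorem mellin_expSeries (hb : ∀ n, |b n| ≤ C * ((n : ℝ) + 1) ^ β) (hβ : 0 ≤ β) (hq : 0 < q)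
    (hσ₀ : 0 ≤ σ₀) (hF : ∀ w : ℂ, 0 < w.re → ‖expSeries b q w‖ ≤ A * w.re ^ (-σ₀))
    (hΛdiff : Differentiable ℂ Λ)
    (hΛ : ∀ s : ℂ, β + 1 < s.re → Λ s = (q : ℂ) ^ (-s) * Complex.Gamma s *
      ∑' n : ℕ, (b n : ℂ) * ((n : ℂ) + 1) ^ (-s))
    {θ : ℝ} (hθ : |θ| < Real.pi / 2) {s : ℂ} (hs : σ₀ < s.re) :
    mellin (fun t : ℝ ↦ expSeries b q (t * Complex.exp (θ * Complex.I))) s =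
      Complex.exp (-(θ * Complex.I * s)) * Λ s := by
  have hθ' := abs_lt.1 hθ
  have hcos : 0 < Real.cos θ := Real.cos_pos_of_mem_Ioo ⟨by linarith, by linarith⟩
  have hre : ∀ t : ℝ, ((t : ℂ) * Complex.exp (θ * Complex.I)).re = t * Real.cos θ := fun t ↦
    re_ofReal_mul_exp_mul_I t θ
  obtain ⟨M, hM0, hM⟩ := exists_norm_expSeries_le hb hq hσ₀ hF
  have hbound : ∀ t : ℝ, 0 < t → ‖expSeries b q (t * Complex.exp (θ * Complex.I))‖ ≤
      M * Real.cos θ ^ (-σ₀) * (t ^ (-σ₀) * Real.exp (-(q / 4 * Real.cos θ) * t)) := fun t ht ↦ by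
    have h := hM (t * Complex.exp (θ * Complex.I)) (by rw [hre]; positivity)
    rw [hre, Real.mul_rpow ht.le hcos.le] at h
    refine h.trans_eq ?_
    ring_nf
  let U : Set ℂ := {z | σ₀ < z.re}
  have hU : IsOpen U := isOpen_lt continuous_const Complex.continuous_re
  have hleft : DifferentiableOn ℂ
      (mellin fun t : ℝ ↦ expSeries b q (t * Complex.exp (θ * Complex.I))) U := fun z hz ↦ by
    refine (mellin_differentiableAt_of_isBigO_rpow_exp (a := q / 4 * Real.cos θ) (b := σ₀)
      (by positivity) ?_ ?_ ?_ hz).differentiableWithinAt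
    · refine ContinuousOn.locallyIntegrableOn ?_ measurableSet_Ioi
      refine (continuousOn_expSeries hb hq).comp (by fun_prop) fun t ht ↦ ?_
      have ht : 0 < t := ht
      simp only [Set.mem_ofPred_eq, hre]
      positivity
    · refine Asymptotics.IsBigO.of_bound (M * Real.cos θ ^ (-σ₀)) ?_
      filter_upwards [Filter.eventually_ge_atTop 1] with t ht
      have ht0 : 0 < t := by linarith
      refine (hbound t ht0).trans ?_
      rw [Real.norm_of_nonneg (Real.exp_pos _).le]
      have : t ^ (-σ₀) ≤ 1 := Real.rpow_le_one_of_one_le_of_nonpos ht (by linarith)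
      refine mul_le_mul_of_nonneg_left ?_ (by positivity)
      exact mul_le_of_le_one_left (Real.exp_pos _).le this
    · refine Asymptotics.IsBigO.of_bound (M * Real.cos θ ^ (-σ₀)) ?_
      filter_upwards [self_mem_nhdsWithin] with t ht
      have ht0 : 0 < t := ht
      refine (hbound t ht0).trans ?_
      rw [Real.norm_of_nonneg (by positivity)]
      refine mul_le_mul_of_nonneg_left ?_ (by positivity)
      refine mul_le_of_le_one_right (by positivity) (Real.exp_le_one_iff.2 ?_)
      have : 0 < q / 4 * Real.cos θ * t := by positivity
      linarith
  have hright : DifferentiableOn ℂ (fun z ↦ Complex.exp (-(θ * Complex.I * z)) * Λ z) U :=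
    (Differentiable.mul (by fun_prop) hΛdiff).differentiableOn
  have hlarge : ∀ z : ℂ, β + 1 < z.re →
      mellin (fun t : ℝ ↦ expSeries b q (t * Complex.exp (θ * Complex.I))) z =
        Complex.exp (-(θ * Complex.I * z)) * Λ z := fun z hz ↦ by
    have hsum := hasSum_mellin_of_re_pos (ι := ℕ) (a := fun n ↦ (b n : ℂ))
      (p := fun n ↦ ((n : ℝ) + 1) * q) (s := z) (w := Complex.exp (θ * Complex.I))
      (F := fun t : ℝ ↦ expSeries b q (t * Complex.exp (θ * Complex.I)))
      (fun n ↦ by positivity) (by linarith) (by rwa [Complex.exp_ofReal_mul_I_re])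
      (fun t ht ↦ by
        have ht : 0 < t := ht
        refine (hasSum_expSeries hb hq (w := t * Complex.exp (θ * Complex.I))
          (by rw [hre]; positivity)).congr_fun fun n ↦ ?_
        push_cast
        ring_nf)
      (by
        have h₀ := (Real.summable_one_div_nat_rpow.2 (show 1 < z.re - β by linarith))
        have h₁ := ((summable_nat_add_iff 1).2 h₀).mul_left (C * q ^ (-z.re))
        refine h₁.of_nonneg_of_le (fun n ↦ by positivity) fun n ↦ ?_
        have hn : (0 : ℝ) < (n : ℝ) + 1 := by positivity
        rw [Real.mul_rpow hn.le hq.le, Complex.norm_real, Real.norm_eq_abs]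
        push_cast
        rw [Real.rpow_sub hn, Real.rpow_neg hq.le, one_div_div]
        calc |b n| / _ ≤ C * ((n : ℝ) + 1) ^ β / (((n : ℝ) + 1) ^ z.re * q ^ z.re) := by
              gcongr
              exact hb n
          _ = _ := by field_simp)
    rw [← hsum.tsum_eq, hΛ z hz, tsum_mul_left]
    have hpow : Complex.exp (θ * Complex.I) ^ (-z) = Complex.exp (-(θ * Complex.I * z)) := by
      rw [Complex.cpow_def_of_ne_zero (Complex.exp_ne_zero _), Complex.log_exp]
      · ring_nf
      · simp; linarith [Real.pi_pos]
      · simp; linarith [Real.pi_pos]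
    have hterm : ∀ n : ℕ, (b n : ℂ) * (((((n : ℝ) + 1) * q : ℝ)) : ℂ) ^ (-z) =
        (q : ℂ) ^ (-z) * ((b n : ℂ) * ((n : ℂ) + 1) ^ (-z)) := fun n ↦ by
      rw [Complex.ofReal_mul, cpow_ofReal_mul (by positivity) (by exact_mod_cast hq.ne')]
      push_cast
      ring
    simp_rw [hterm, tsum_mul_left]
    rw [hpow]
    ring
  refine (hleft.analyticOnNhd hU).eqOn_of_preconnected_of_eventuallyEq (hright.analyticOnNhd hU)
    (convex_halfSpace_re_gt σ₀).isPreconnected (z₀ := ((max σ₀ (β + 1) + 1 : ℝ) : ℂ)) ?_ ?_ hs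
  · have := le_max_left σ₀ (β + 1)
    simp only [U, Set.mem_ofPred_eq, Complex.ofReal_re]
    linarith
  · have : {z : ℂ | β + 1 < z.re} ∈ nhds ((max σ₀ (β + 1) + 1 : ℝ) : ℂ) := by
      refine (isOpen_lt continuous_const Complex.continuous_re).mem_nhds ?_
      have := le_max_right σ₀ (β + 1)
      simp only [Set.mem_ofPred_eq, Complex.ofReal_re]
      linarith
    filter_upwards [this] with z hz
    exact hlarge z hz

open FourierTransform in
theorem fourier_rotatedKernel (hb : ∀ n, |b n| ≤ C * ((n : ℝ) + 1) ^ β) (hβ : 0 ≤ β) (hq : 0 < q)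
    (hσ₀ : 0 ≤ σ₀) (hF : ∀ w : ℂ, 0 < w.re → ‖expSeries b q w‖ ≤ A * w.re ^ (-σ₀))
    (hΛdiff : Differentiable ℂ Λ)
    (hΛ : ∀ s : ℂ, β + 1 < s.re → Λ s = (q : ℂ) ^ (-s) * Complex.Gamma s *
      ∑' n : ℕ, (b n : ℂ) * ((n : ℂ) + 1) ^ (-s))
    {θ : ℝ} (hθ : |θ| < Real.pi / 2) {σ : ℝ} (hσ : σ₀ < σ) (t : ℝ) :
    𝓕 (rotatedKernel b q θ σ) (t / (2 * Real.pi)) =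
      Complex.exp (-(θ * Complex.I * (σ + t * Complex.I))) * Λ (σ + t * Complex.I) := by
  have hre : ((σ : ℂ) + t * Complex.I).re = σ := by simp
  have him : ((σ : ℂ) + t * Complex.I).im = t := by simp
  have h := mellin_expSeries hb hβ hq hσ₀ hF hΛdiff hΛ hθ (s := σ + t * Complex.I) (by rwa [hre])
  rw [mellin_eq_fourier, hre, him] at h
  exact h

theorem norm_natCast_add_one_cpow (n : ℕ) (s : ℂ) :
    ‖((n : ℂ) + 1) ^ s‖ = ((n : ℝ) + 1) ^ s.re := by
  rw [show ((n : ℂ) + 1) = (((n : ℝ) + 1 : ℝ) : ℂ) by push_cast; ring,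
    Complex.norm_cpow_eq_rpow_re_of_pos (by positivity)]

theorem summable_abs_mul_rpow (hb : ∀ n, |b n| ≤ C * ((n : ℝ) + 1) ^ β) {x : ℝ}
    (hx : β + 1 < x) :
    Summable fun n : ℕ ↦ |b n| * ((n : ℝ) + 1) ^ (-x) := by
  have h₀ := Real.summable_one_div_nat_rpow.2 (show 1 < x - β by linarith)
  refine (((summable_nat_add_iff 1).2 h₀).mul_left C).of_nonneg_of_le (fun n ↦ by positivity)
    fun n ↦ ?_
  have hn : (0 : ℝ) < (n : ℝ) + 1 := by positivity
  push_cast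
  rw [one_div, ← Real.rpow_neg hn.le, neg_sub, sub_eq_add_neg, Real.rpow_add hn, ← mul_assoc]
  gcongr
  exact hb n

theorem summable_mul_cpow_neg (hb : ∀ n, |b n| ≤ C * ((n : ℝ) + 1) ^ β) {s : ℂ}
    (hs : β + 1 < s.re) : Summable fun n : ℕ ↦ (b n : ℂ) * ((n : ℂ) + 1) ^ (-s) := by
  refine Summable.of_norm ?_
  simp only [norm_mul, Complex.norm_real, Real.norm_eq_abs, norm_natCast_add_one_cpow,
    Complex.neg_re]
  exact summable_abs_mul_rpow hb hs

end ExpSeries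

/-- `Λ` is the completed Dirichlet series of the coefficients `b` (indexed from `0`), it is entire,
and the exponential series of `b` has size `O((re w) ^ (-σ₀))` on the right half-plane. -/
structure IsCompletedSeries (b : ℕ → ℝ) (q σ₀ C β A : ℝ) (Λ : ℂ → ℂ) : Prop where
  abs_le : ∀ n, |b n| ≤ C * ((n : ℝ) + 1) ^ β
  exponent_nonneg : 0 ≤ β
  pos : 0 < q
  half_le : 1 / 2 ≤ σ₀
  norm_expSeries_le : ∀ w : ℂ, 0 < w.re → ‖expSeries b q w‖ ≤ A * w.re ^ (-σ₀)
  differentiable : Differentiable ℂ Λ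
  eq_mul_tsum : ∀ s : ℂ, β + 1 < s.re → Λ s = (q : ℂ) ^ (-s) * Complex.Gamma s *
    ∑' n : ℕ, (b n : ℂ) * ((n : ℂ) + 1) ^ (-s)

/-- The Dirichlet series underlying the completed series `Λ`. -/
noncomputable def dirichletPart (q : ℝ) (Λ : ℂ → ℂ) (s : ℂ) : ℂ :=
  (q : ℂ) ^ s * Λ s * (Complex.Gamma s)⁻¹

namespace IsCompletedSeries

variable {b : ℕ → ℝ} {q σ₀ C β A : ℝ} {Λ : ℂ → ℂ}

theorem nonneg (h : IsCompletedSeries b q σ₀ C β A Λ) : 0 ≤ σ₀ := by linarith [h.half_le]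

open FourierTransform in
theorem fourier_eq (h : IsCompletedSeries b q σ₀ C β A Λ) {θ : ℝ} (hθ : |θ| < Real.pi / 2) {σ : ℝ}
    (hσ : σ₀ < σ) (t : ℝ) :
    𝓕 (rotatedKernel b q θ σ) (t / (2 * Real.pi)) =
      Complex.exp (-(θ * Complex.I * (σ + t * Complex.I))) * Λ (σ + t * Complex.I) :=
  fourier_rotatedKernel h.abs_le h.exponent_nonneg h.pos h.nonneg h.norm_expSeries_le
    h.differentiable h.eq_mul_tsum hθ hσ t

open MeasureTheory FourierTransform in
theorem exists_integral_norm_sq_le (h : IsCompletedSeries b q σ₀ C β A Λ) (c : ℝ) :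
    ∃ K > (0 : ℝ), ∀ θ : ℝ, |θ| < Real.pi / 2 → ∀ σ : ℝ, σ₀ < σ → σ ≤ c →
      (Integrable fun t : ℝ ↦ ‖Complex.exp (-(θ * Complex.I * (σ + t * Complex.I))) *
        Λ (σ + t * Complex.I)‖ ^ 2) ∧
      ∫ t : ℝ, ‖Complex.exp (-(θ * Complex.I * (σ + t * Complex.I))) *
        Λ (σ + t * Complex.I)‖ ^ 2 ≤ K * Real.cos θ ^ (-(2 * σ)) / (σ - σ₀) := by
  obtain ⟨K, hK0, hK⟩ := exists_norm_rotatedKernel_le h.abs_le h.pos h.nonneg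
    h.norm_expSeries_le c
  refine ⟨2 * Real.pi * K ^ 2, by positivity, fun θ hθ σ hσ hσc ↦ ?_⟩
  have hθ' := abs_lt.1 hθ
  have hcos : 0 < Real.cos θ := Real.cos_pos_of_mem_Ioo ⟨by linarith, by linarith⟩
  obtain ⟨h₁, h₂, h₃⟩ := integral_norm_sq_le_of_norm_le_exp
    (continuous_rotatedKernel h.abs_le h.pos hcos σ) (sub_pos.2 hσ)
    (fun u ↦ hK θ σ u hcos hσ.le hσc)
  obtain ⟨h₄, h₅⟩ := integral_norm_sq_fourier h₁ h₂
  simp_rw [← h.fourier_eq hθ hσ]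
  refine ⟨h₄.comp_div (by positivity), ?_⟩
  rw [Measure.integral_comp_div (fun ξ ↦ ‖𝓕 (rotatedKernel b q θ σ) ξ‖ ^ 2), h₅,
    abs_of_pos (by positivity), smul_eq_mul]
  calc _ ≤ 2 * Real.pi * ((K * Real.cos θ ^ (-σ)) ^ 2 / (σ - σ₀)) := by gcongr
    _ = _ := by
      rw [mul_pow, ← Real.rpow_natCast (Real.cos θ ^ (-σ)) 2, ← Real.rpow_mul hcos.le]
      push_cast
      ring_nf

open MeasureTheory FourierTransform in
theorem exists_integral_norm_sq_average_le (h : IsCompletedSeries b q σ₀ C β A Λ) :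
    ∃ K > (0 : ℝ), ∀ θ : ℝ, |θ| < Real.pi / 2 → ∀ H : ℝ, 0 < H → ∀ x y : ℝ, x ≤ y →
      ∫ t in x..y, ‖∫ u in (0 : ℝ)..H,
        Complex.exp (-(θ * Complex.I * (σ₀ + (t + u : ℝ) * Complex.I))) *
          Λ (σ₀ + (t + u : ℝ) * Complex.I)‖ ^ 2 ≤ K * H * Real.cos θ ^ (-(2 * σ₀)) := by
  obtain ⟨K, hK0, hK⟩ := exists_norm_rotatedKernel_le h.abs_le h.pos h.nonneg
    h.norm_expSeries_le (σ₀ + 1)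
  refine ⟨2 * Real.pi * K ^ 2 * (4 * Real.pi), by positivity, fun θ hθ H hH x y hxy ↦ ?_⟩
  have hθ' := abs_lt.1 hθ
  have hcos : 0 < Real.cos θ := Real.cos_pos_of_mem_Ioo ⟨by linarith, by linarith⟩
  let E : ℝ → ℝ → ℂ := fun σ t ↦ Complex.exp (-(θ * Complex.I * (σ + t * Complex.I))) *
    Λ (σ + t * Complex.I)
  have hΛc := h.differentiable.continuous
  have hEc : Continuous (Function.uncurry E) := by
    simp only [E, Function.uncurry_def]
    fun_prop
  let G : ℝ → ℝ → ℝ := fun σ t ↦ ‖∫ u in (0 : ℝ)..H, E σ (t + u)‖ ^ 2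
  have hGc : Continuous (Function.uncurry G) := by
    have : Continuous fun z : ℝ × ℝ ↦ ∫ u in (0 : ℝ)..H, E z.1 (z.2 + u) :=
      intervalIntegral.continuous_parametric_intervalIntegral_of_continuous'
        (f := fun (z : ℝ × ℝ) u ↦ E z.1 (z.2 + u))
        (hEc.comp (by fun_prop : Continuous fun p : (ℝ × ℝ) × ℝ ↦ (p.1.1, p.1.2 + p.2))) _ _
    exact this.norm.pow 2
  have hIc : Continuous fun σ ↦ ∫ t in x..y, G σ t :=
    intervalIntegral.continuous_parametric_intervalIntegral_of_continuous' hGc _ _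
  have hbd : ∀ σ, σ₀ < σ → σ ≤ σ₀ + 1 → ∫ t in x..y, G σ t ≤
      2 * Real.pi * K ^ 2 * (4 * Real.pi) * H * Real.cos θ ^ (-(2 * σ)) := fun σ hσ hσ1 ↦ by
    have hg := continuous_rotatedKernel h.abs_le h.pos hcos σ
    obtain ⟨h₁, -, -⟩ := integral_norm_sq_le_of_norm_le_exp hg (sub_pos.2 hσ)
      (fun u ↦ hK θ σ u hcos hσ.le hσ1)
    obtain ⟨i₁, i₂⟩ := integral_norm_sq_intervalIntegral_fourier_le hg h₁
      (A := K * Real.cos θ ^ (-σ)) (fun u ↦ (hK θ σ u hcos hσ.le hσ1).trans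
        (mul_le_of_le_one_right (by positivity) (Real.exp_le_one_iff.2 (by
          have : 0 ≤ (σ - σ₀) * |u - Real.log (Real.cos θ)| :=
            mul_nonneg (by linarith) (abs_nonneg _)
          linarith)))) hH
    have hG : ∀ t, G σ t = ‖∫ u in (0 : ℝ)..H,
        𝓕 (rotatedKernel b q θ σ) (t / (2 * Real.pi) + u / (2 * Real.pi))‖ ^ 2 := fun t ↦ by
      simp_rw [← add_div, h.fourier_eq hθ hσ]
      rfl
    have hGi : Integrable (G σ) := by
      simp_rw [funext hG]
      exact i₁.comp_div (by positivity)
    rw [intervalIntegral.integral_of_le hxy]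
    refine (setIntegral_le_integral hGi (.of_forall fun t ↦ by simp only [G]; positivity)).trans ?_
    simp_rw [funext hG]
    rw [Measure.integral_comp_div (fun ξ ↦ ‖∫ u in (0 : ℝ)..H,
      𝓕 (rotatedKernel b q θ σ) (ξ + u / (2 * Real.pi))‖ ^ 2), abs_of_pos (by positivity),
      smul_eq_mul]
    calc _ ≤ 2 * Real.pi * ((K * Real.cos θ ^ (-σ)) ^ 2 * (4 * Real.pi * H)) := by gcongr
      _ = _ := by
        rw [mul_pow, ← Real.rpow_natCast (Real.cos θ ^ (-σ)) 2, ← Real.rpow_mul hcos.le]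
        push_cast
        ring_nf
  have hrc : Continuous fun σ : ℝ ↦
      2 * Real.pi * K ^ 2 * (4 * Real.pi) * H * Real.cos θ ^ (-(2 * σ)) :=
    continuous_const.mul (Continuous.rpow continuous_const (by fun_prop) fun _ ↦ Or.inl hcos.ne')
  refine le_of_tendsto_of_tendsto (b := nhdsWithin σ₀ (Set.Ioi σ₀))
    ((hIc.tendsto σ₀).mono_left nhdsWithin_le_nhds)
    ((hrc.tendsto σ₀).mono_left nhdsWithin_le_nhds) ?_
  filter_upwards [Ioc_mem_nhdsGT (show σ₀ < σ₀ + 1 by linarith)] with σ hσ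
  exact hbd σ hσ.1 hσ.2

theorem cos_pi_div_two_sub_inv_rpow_le {T x : ℝ} (hT : 1 ≤ T) (hx : 0 ≤ x) :
    Real.cos (Real.pi / 2 - 1 / T) ^ (-x) ≤ (2 * T) ^ x := by
  have hT0 : 0 < T := by linarith
  have h1 : 1 / T ≤ 1 := (div_le_one hT0).2 hT
  rw [Real.cos_pi_div_two_sub]
  have h2 := Real.mul_le_sin (x := 1 / T) (by positivity) (by linarith [Real.pi_gt_three])
  have h3 : 1 / (2 * T) ≤ Real.sin (1 / T) := by
    refine le_trans ?_ h2
    rw [div_mul_div_comm, mul_one, div_le_div_iff₀ (by positivity) (by positivity)]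
    nlinarith [Real.pi_le_four]
  have h4 : (2 * T) ^ x = (1 / (2 * T)) ^ (-x) := by
    rw [one_div, Real.inv_rpow (by positivity), Real.rpow_neg (by positivity), inv_inv]
  rw [h4]
  exact Real.rpow_le_rpow_of_nonpos (by positivity) h3 (by linarith)

theorem abs_pi_div_two_sub_inv_lt {T : ℝ} (hT : 1 ≤ T) :
    |Real.pi / 2 - 1 / T| < Real.pi / 2 := by
  have hT0 : 0 < T := by linarith
  have h1 : 1 / T ≤ 1 := (div_le_one hT0).2 hT
  have h0 : 0 < 1 / T := by positivity
  rw [abs_lt]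
  constructor <;> linarith [Real.pi_gt_three]

theorem norm_exp_rotation (θ σ t : ℝ) :
    ‖Complex.exp (-(θ * Complex.I * (σ + t * Complex.I)))‖ = Real.exp (θ * t) := by
  rw [Complex.norm_exp]
  simp

theorem differentiable_dirichletPart (h : IsCompletedSeries b q σ₀ C β A Λ) :
    Differentiable ℂ (dirichletPart q Λ) := by
  have hq : (q : ℂ) ≠ 0 := by exact_mod_cast h.pos.ne'
  refine Differentiable.mul (Differentiable.mul ?_ h.differentiable)
    Complex.differentiable_one_div_Gamma
  exact fun s ↦ differentiableAt_id.const_cpow (Or.inl hq)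

theorem exists_norm_dirichletPart_le (h : IsCompletedSeries b q σ₀ C β A Λ) (c : ℝ) :
    ∃ K > (0 : ℝ), ∀ σ t T : ℝ, σ₀ ≤ σ → σ ≤ c → 1 ≤ T → t ∈ Set.Icc T (4 * T) →
      ‖dirichletPart q Λ (σ + t * Complex.I)‖ ≤
        K * T ^ (1 / 2 - σ) * (Real.exp ((Real.pi / 2 - 1 / T) * t) *
          ‖Λ (σ + t * Complex.I)‖) := by
  obtain ⟨k, hk0, hk⟩ := exists_le_norm_Gamma
  refine ⟨max 1 q ^ c * Real.exp 4 / k, by positivity, fun σ t T hσ hσc hT ht ↦ ?_⟩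
  have hT0 : 0 < T := by linarith
  have ht0 : 0 < t := by linarith [ht.1]
  have hσ2 : 1 / 2 ≤ σ := h.half_le.trans hσ
  have hΓ := hk σ t hσ2 (hT.trans ht.1)
  have hq := h.pos
  have e₁ : ‖(q : ℂ) ^ ((σ : ℂ) + t * Complex.I)‖ ≤ max 1 q ^ c := by
    rw [Complex.norm_cpow_eq_rpow_re_of_pos hq]
    simp only [Complex.add_re, Complex.ofReal_re, Complex.mul_re, Complex.I_re, mul_zero,
      Complex.ofReal_im, Complex.I_im, mul_one, sub_self, add_zero]
    exact (Real.rpow_le_rpow hq.le (le_max_right 1 q) (by linarith)).trans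
      (Real.rpow_le_rpow_of_exponent_le (le_max_left _ _) hσc)
  have e₂ : ‖(Complex.Gamma ((σ : ℂ) + t * Complex.I))⁻¹‖ ≤
      T ^ (1 / 2 - σ) * (Real.exp 4 * Real.exp ((Real.pi / 2 - 1 / T) * t)) / k := by
    rw [norm_inv]
    refine (inv_anti₀ (by positivity) hΓ).trans ?_
    have f₁ : (t ^ (σ - 1 / 2))⁻¹ ≤ T ^ (1 / 2 - σ) := by
      rw [← Real.rpow_neg ht0.le, neg_sub]
      exact Real.rpow_le_rpow_of_nonpos hT0 ht.1 (by linarith)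
    have f₂ : (Real.exp (-(Real.pi / 2 * t)))⁻¹ ≤
        Real.exp 4 * Real.exp ((Real.pi / 2 - 1 / T) * t) := by
      rw [← Real.exp_neg, neg_neg, ← Real.exp_add]
      refine Real.exp_le_exp.2 ?_
      have : 1 / T * t ≤ 4 := by
        rw [one_div_mul_eq_div, div_le_iff₀ hT0]
        exact ht.2
      linarith
    rw [mul_inv, mul_inv, mul_assoc, mul_comm, ← div_eq_mul_inv]
    gcongr
  rw [dirichletPart, norm_mul, norm_mul]
  calc _ ≤ max 1 q ^ c * ‖Λ (σ + t * Complex.I)‖ *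
        (T ^ (1 / 2 - σ) * (Real.exp 4 * Real.exp ((Real.pi / 2 - 1 / T) * t)) / k) := by gcongr
    _ = _ := by ring

open MeasureTheory in
theorem exists_integral_norm_sq_dirichletPart_le (h : IsCompletedSeries b q σ₀ C β A Λ) (c : ℝ) :
    ∃ K > (0 : ℝ), ∀ T : ℝ, 1 ≤ T → ∀ σ : ℝ, σ₀ < σ → σ ≤ c →
      ∫ t in T..(4 * T), ‖dirichletPart q Λ (σ + t * Complex.I)‖ ^ 2 ≤ K * T / (σ - σ₀) := by
  obtain ⟨K₁, hK₁0, hK₁⟩ := h.exists_norm_dirichletPart_le c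
  obtain ⟨K₂, hK₂0, hK₂⟩ := h.exists_integral_norm_sq_le c
  refine ⟨K₁ ^ 2 * K₂ * 2 ^ (2 * c), by positivity, fun T hT σ hσ hσc ↦ ?_⟩
  have hT0 : 0 < T := by linarith
  obtain ⟨i₁, i₂⟩ := hK₂ _ (abs_pi_div_two_sub_inv_lt hT) σ hσ hσc
  have hc0 : 0 ≤ σ := h.nonneg.trans hσ.le
  have hcos := cos_pi_div_two_sub_inv_rpow_le hT (x := 2 * σ) (by positivity)
  have hLc : Continuous fun t : ℝ ↦ ‖dirichletPart q Λ (σ + t * Complex.I)‖ ^ 2 := by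
    have := h.differentiable_dirichletPart.continuous
    fun_prop
  have hTT : T ≤ 4 * T := by linarith
  have hσσ := sub_pos.2 hσ
  rw [intervalIntegral.integral_of_le hTT]
  calc _ ≤ ∫ t in Set.Ioc T (4 * T), K₁ ^ 2 * T ^ (1 - 2 * σ) *
        ‖Complex.exp (-((Real.pi / 2 - 1 / T : ℝ) * Complex.I * (σ + t * Complex.I))) *
          Λ (σ + t * Complex.I)‖ ^ 2 := by
        refine setIntegral_mono_on hLc.integrableOn_Ioc (i₁.const_mul _).integrableOn
          measurableSet_Ioc fun t ht ↦ ?_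
        have := pow_le_pow_left₀ (norm_nonneg _)
          (hK₁ σ t T hσ.le hσc hT (Set.Ioc_subset_Icc_self ht)) 2
        refine this.trans_eq ?_
        rw [norm_mul, norm_exp_rotation, mul_pow, mul_pow K₁, ← Real.rpow_natCast (T ^ _) 2,
          ← Real.rpow_mul hT0.le]
        push_cast
        ring_nf
    _ ≤ K₁ ^ 2 * T ^ (1 - 2 * σ) * (K₂ * (2 * T) ^ (2 * σ) / (σ - σ₀)) := by
        rw [integral_const_mul]
        refine mul_le_mul_of_nonneg_left ?_ (by positivity)
        refine (setIntegral_le_integral i₁ (.of_forall fun t ↦ by positivity)).trans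
          (i₂.trans ?_)
        gcongr
    _ = K₁ ^ 2 * K₂ * 2 ^ (2 * σ) * T / (σ - σ₀) := by
        rw [Real.mul_rpow two_pos.le hT0.le]
        have : T ^ (1 - 2 * σ) * T ^ (2 * σ) = T := by
          rw [← Real.rpow_add hT0, sub_add_cancel, Real.rpow_one]
        linear_combination (K₁ ^ 2 * K₂ * 2 ^ (2 * σ) / (σ - σ₀)) * this
    _ ≤ _ := by
        gcongr
        norm_num

theorem exists_integral_norm_sq_rotated_average_le (h : IsCompletedSeries b q σ₀ C β A Λ) :
    ∃ K > (0 : ℝ), ∀ T : ℝ, 1 ≤ T → ∀ H : ℝ, 0 < H →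
      ∫ t in T..(2 * T), ‖∫ u in t..(t + H),
        (Real.exp ((Real.pi / 2 - 1 / T) * u) : ℂ) * Λ (σ₀ + u * Complex.I)‖ ^ 2 ≤
          K * H * T ^ (2 * σ₀) := by
  obtain ⟨K, hK0, hK⟩ := h.exists_integral_norm_sq_average_le
  refine ⟨K * 2 ^ (2 * σ₀), by positivity, fun T hT H hH ↦ ?_⟩
  have hT0 : 0 < T := by linarith
  have h₁ := hK _ (abs_pi_div_two_sub_inv_lt hT) H hH T (2 * T) (by linarith)
  set θ := Real.pi / 2 - 1 / T
  have hθσ : ‖Complex.exp (-(θ * Complex.I * σ₀))‖ = 1 := by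
    simpa using norm_exp_rotation θ σ₀ 0
  have e : ∀ t : ℝ, ‖∫ u in t..(t + H), (Real.exp (θ * u) : ℂ) * Λ (σ₀ + u * Complex.I)‖ =
      ‖∫ u in (0 : ℝ)..H, Complex.exp (-(θ * Complex.I * (σ₀ + (t + u : ℝ) * Complex.I))) *
          Λ (σ₀ + (t + u : ℝ) * Complex.I)‖ := fun t ↦ by
    rw [intervalIntegral.integral_comp_add_left (fun v : ℝ ↦
      Complex.exp (-(θ * Complex.I * (σ₀ + v * Complex.I))) * Λ (σ₀ + v * Complex.I)),
      add_zero, ← one_mul ‖∫ u in t..(t + H), _‖, ← hθσ, ← norm_mul,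
      ← intervalIntegral.integral_const_mul]
    congr with u
    rw [← mul_assoc, Complex.ofReal_exp, ← Complex.exp_add]
    congr 2
    push_cast
    linear_combination (θ * u : ℂ) * Complex.I_sq
  simp_rw [e]
  refine h₁.trans ?_
  have := cos_pi_div_two_sub_inv_rpow_le hT (x := 2 * σ₀) (by linarith [h.nonneg])
  rw [Real.mul_rpow two_pos.le hT0.le] at this
  calc _ ≤ K * H * (2 ^ (2 * σ₀) * T ^ (2 * σ₀)) := by gcongr
    _ = _ := by ring

theorem hasSum_dirichletPart (h : IsCompletedSeries b q σ₀ C β A Λ) {s : ℂ} (hs : β + 1 < s.re) :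
    HasSum (fun n : ℕ ↦ (b n : ℂ) * ((n : ℂ) + 1) ^ (-s)) (dirichletPart q Λ s) := by
  have hq : (q : ℂ) ≠ 0 := by exact_mod_cast h.pos.ne'
  have hΓ : Complex.Gamma s ≠ 0 :=
    Complex.Gamma_ne_zero_of_re_pos (by linarith [h.exponent_nonneg])
  have : dirichletPart q Λ s = ∑' n : ℕ, (b n : ℂ) * ((n : ℂ) + 1) ^ (-s) := by
    have hqs : (q : ℂ) ^ s ≠ 0 := by simp [Complex.cpow_eq_zero_iff, hq]
    rw [dirichletPart, h.eq_mul_tsum s hs, Complex.cpow_neg]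
    field_simp
  rw [this]
  exact (summable_mul_cpow_neg h.abs_le hs).hasSum

theorem exists_norm_sub_leading_term_le (h : IsCompletedSeries b q σ₀ C β A Λ) {n₀ : ℕ}
    (hn₀ : b n₀ ≠ 0) (hmin : ∀ n < n₀, b n = 0) :
    ∃ c, σ₀ < c ∧ ∀ s : ℂ, s.re = c →
      ‖dirichletPart q Λ s * ((n₀ : ℂ) + 1) ^ (s - σ₀) - b n₀ * ((n₀ : ℂ) + 1) ^ (-σ₀ : ℂ)‖ ≤
        |b n₀| * ((n₀ : ℝ) + 1) ^ (-σ₀) / 2 := by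
  set P : ℝ := (n₀ : ℝ) + 1 with hP
  have hP0 : 0 < P := by positivity
  set c₀ : ℝ := max (β + 2) (σ₀ + 1)
  have hc₀ : β + 1 < c₀ := lt_of_lt_of_le (by linarith) (le_max_left _ _)
  have hsum₀ := summable_abs_mul_rpow h.abs_le hc₀
  set S := ∑' n : ℕ, |b n| * ((n : ℝ) + 1) ^ (-c₀) with hS
  have hS0 : 0 ≤ S := tsum_nonneg fun n ↦ by positivity
  set ρ : ℝ := P / (P + 1)
  have hρ0 : 0 ≤ ρ := by positivity
  have hρ1 : ρ < 1 := (div_lt_one (by positivity)).2 (by linarith)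
  have hb0 : 0 < |b n₀| := abs_pos.2 hn₀
  obtain ⟨m, hm⟩ := exists_pow_lt_of_lt_one
    (show 0 < |b n₀| / (2 * (P ^ c₀ * S + 1)) by positivity) hρ1
  rw [lt_div_iff₀ (by positivity)] at hm
  refine ⟨c₀ + m, ?_, fun s hs ↦ ?_⟩
  · have := le_max_right (β + 2) (σ₀ + 1)
    have : (0 : ℝ) ≤ m := Nat.cast_nonneg m
    linarith
  have hPc : ((n₀ : ℂ) + 1) ≠ 0 := Nat.cast_add_one_ne_zero n₀
  have hsre : β + 1 < s.re := by
    have : (0 : ℝ) ≤ m := Nat.cast_nonneg m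
    linarith
  have hL := h.hasSum_dirichletPart hsre
  have hsplit := hL.summable.tsum_eq_add_tsum_ite n₀
  rw [hL.tsum_eq] at hsplit
  have hfactor : dirichletPart q Λ s * ((n₀ : ℂ) + 1) ^ (s - σ₀) -
      b n₀ * ((n₀ : ℂ) + 1) ^ (-σ₀ : ℂ) = ∑' n : ℕ, ((n₀ : ℂ) + 1) ^ (s - σ₀) *
        (if n = n₀ then 0 else (b n : ℂ) * ((n : ℂ) + 1) ^ (-s)) := by
    rw [tsum_mul_left, hsplit, add_mul, mul_assoc, ← Complex.cpow_add _ _ hPc,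
      show -s + (s - σ₀) = (-σ₀ : ℂ) by ring]
    ring
  have hterm : ∀ n : ℕ, ‖((n₀ : ℂ) + 1) ^ (s - σ₀) *
      (if n = n₀ then 0 else (b n : ℂ) * ((n : ℂ) + 1) ^ (-s))‖ ≤
        P ^ (-σ₀) * ρ ^ m * P ^ c₀ * (|b n| * ((n : ℝ) + 1) ^ (-c₀)) := fun n ↦ by
    rcases lt_trichotomy n n₀ with hn | hn | hn
    · simp [hmin n hn]
    · rw [if_pos hn, mul_zero, norm_zero]
      positivity
    · have hnP : P + 1 ≤ (n : ℝ) + 1 := by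
        have : ((n₀ + 1 : ℕ) : ℝ) ≤ n := Nat.cast_le.2 hn
        push_cast at this
        linarith
      have hn0 : (0 : ℝ) < (n : ℝ) + 1 := by positivity
      rw [if_neg hn.ne', norm_mul, norm_mul, norm_natCast_add_one_cpow, norm_natCast_add_one_cpow,
        Complex.norm_real, Real.norm_eq_abs, Complex.neg_re, Complex.sub_re, Complex.ofReal_re, hs,
        ← hP]
      have e₁ : P ^ (c₀ + m - σ₀) = P ^ (-σ₀) * P ^ c₀ * P ^ m := by
        rw [← Real.rpow_natCast, ← Real.rpow_add hP0, ← Real.rpow_add hP0]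
        ring_nf
      have e₂ : ((n : ℝ) + 1) ^ (-(c₀ + m)) = ((n : ℝ) + 1) ^ (-c₀) * (((n : ℝ) + 1) ^ m)⁻¹ := by
        rw [neg_add, Real.rpow_add hn0, Real.rpow_neg hn0.le m, Real.rpow_natCast]
      have e₃ : P ^ m * (((n : ℝ) + 1) ^ m)⁻¹ ≤ ρ ^ m := by
        rw [← div_eq_mul_inv, ← div_pow]
        refine pow_le_pow_left₀ (by positivity) ?_ m
        exact div_le_div_of_nonneg_left hP0.le (by positivity) hnP
      rw [e₁, e₂]
      calc _ = P ^ (-σ₀) * (P ^ m * (((n : ℝ) + 1) ^ m)⁻¹) * P ^ c₀ *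
            (|b n| * ((n : ℝ) + 1) ^ (-c₀)) := by ring
        _ ≤ _ := by gcongr
  have hsum₁ := hsum₀.mul_left (P ^ (-σ₀) * ρ ^ m * P ^ c₀)
  have hsum₂ := hsum₁.of_nonneg_of_le (fun n ↦ norm_nonneg _) hterm
  rw [hfactor]
  refine (norm_tsum_le_tsum_norm hsum₂).trans ((hsum₂.tsum_le_tsum hterm hsum₁).trans ?_)
  rw [tsum_mul_left, ← hS]
  have hρm : 0 ≤ ρ ^ m := by positivity
  have hσ := Real.rpow_pos_of_pos hP0 (-σ₀)
  calc P ^ (-σ₀) * ρ ^ m * P ^ c₀ * S = P ^ (-σ₀) * (ρ ^ m * (P ^ c₀ * S)) := by ring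
    _ ≤ P ^ (-σ₀) * (|b n₀| / 2) := by
      gcongr
      nlinarith
    _ = _ := by ring

theorem exists_le_integral_norm_dirichletPart (h : IsCompletedSeries b q σ₀ C β A Λ)
    (hb : ∃ n, b n ≠ 0) :
    ∃ c, σ₀ < c ∧ ∃ μ > (0 : ℝ), ∃ B > (0 : ℝ), ∀ t H : ℝ, 0 < H →
      μ * H ≤ (∫ u in t..(t + H), ‖dirichletPart q Λ (σ₀ + u * Complex.I)‖) +
        B * (∫ σ in σ₀..c, ‖dirichletPart q Λ (σ + t * Complex.I)‖) +
        B * ∫ σ in σ₀..c, ‖dirichletPart q Λ (σ + (t + H : ℝ) * Complex.I)‖ := by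
  classical
  obtain ⟨n₀, hn₀, hmin⟩ : ∃ n₀, b n₀ ≠ 0 ∧ ∀ n < n₀, b n = 0 :=
    ⟨Nat.find hb, Nat.find_spec hb, fun n hn ↦ not_not.1 (Nat.find_min hb hn)⟩
  obtain ⟨c, hc, hlead⟩ := h.exists_norm_sub_leading_term_le hn₀ hmin
  set P : ℝ := (n₀ : ℝ) + 1 with hP
  have hP1 : 1 ≤ P := by linarith [Nat.cast_nonneg (α := ℝ) n₀]
  have hP0 : 0 < P := by positivity
  have hb0 : 0 < |b n₀| := abs_pos.2 hn₀
  refine ⟨c, hc, |b n₀| * P ^ (-σ₀) / 2, by positivity, P ^ (c - σ₀), by positivity,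
    fun t H hH ↦ ?_⟩
  have hLd := h.differentiable_dirichletPart
  have hLc := hLd.continuous
  let D : ℂ → ℂ := fun s ↦ dirichletPart q Λ s * ((n₀ : ℂ) + 1) ^ (s - σ₀)
  have hPc : ((n₀ : ℂ) + 1) ≠ 0 := Nat.cast_add_one_ne_zero n₀
  have hD : Differentiable ℂ D :=
    hLd.mul fun s ↦ (differentiableAt_id.sub_const _).const_cpow (Or.inl hPc)
  have hDc := hD.continuous
  have hDn : ∀ s, ‖D s‖ = ‖dirichletPart q Λ s‖ * P ^ (s.re - σ₀) := fun s ↦ by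
    simp only [D]
    rw [norm_mul, norm_natCast_add_one_cpow, Complex.sub_re, Complex.ofReal_re]
  have hrect := Complex.integral_boundary_rect_eq_zero_of_differentiableOn D
    (σ₀ + t * Complex.I) (c + (t + H : ℝ) * Complex.I) hD.differentiableOn
  have r₁ : ((σ₀ : ℂ) + t * Complex.I).re = σ₀ := by simp
  have r₂ : ((σ₀ : ℂ) + t * Complex.I).im = t := by simp
  have r₃ : ((c : ℂ) + (t + H : ℝ) * Complex.I).re = c := by simp
  have r₄ : ((c : ℂ) + (t + H : ℝ) * Complex.I).im = t + H := by simp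
  rw [r₁, r₂, r₃, r₄] at hrect
  have hhor : ∀ v : ℝ, ‖∫ x in σ₀..c, D (x + v * Complex.I)‖ ≤
      P ^ (c - σ₀) * ∫ σ in σ₀..c, ‖dirichletPart q Λ (σ + v * Complex.I)‖ := fun v ↦ by
    rw [← intervalIntegral.integral_const_mul]
    refine (intervalIntegral.norm_integral_le_integral_norm hc.le).trans ?_
    refine intervalIntegral.integral_mono_on hc.le (Continuous.intervalIntegrable (by fun_prop) _ _)
      (Continuous.intervalIntegrable (by fun_prop) _ _) fun x hx ↦ ?_
    rw [hDn, mul_comm]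
    refine mul_le_mul_of_nonneg_right (Real.rpow_le_rpow_of_exponent_le hP1 ?_) (norm_nonneg _)
    simpa using hx.2
  have hleft : ‖∫ y in t..(t + H), D (σ₀ + y * Complex.I)‖ ≤
      ∫ u in t..(t + H), ‖dirichletPart q Λ (σ₀ + u * Complex.I)‖ := by
    refine (intervalIntegral.norm_integral_le_integral_norm (by linarith)).trans_eq ?_
    congr with u
    rw [hDn]
    simp
  have hright : |b n₀| * P ^ (-σ₀) / 2 * H ≤ ‖∫ y in t..(t + H), D (c + y * Complex.I)‖ := by
    set Z : ℂ := b n₀ * ((n₀ : ℂ) + 1) ^ (-σ₀ : ℂ)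
    have hZ : ‖Z‖ = |b n₀| * P ^ (-σ₀) := by
      simp only [Z]
      rw [norm_mul, norm_natCast_add_one_cpow, Complex.norm_real, Real.norm_eq_abs,
        Complex.neg_re, Complex.ofReal_re]
    have e : ‖∫ y in t..(t + H), (D (c + y * Complex.I) - Z)‖ ≤
        |b n₀| * P ^ (-σ₀) / 2 * |t + H - t| :=
      intervalIntegral.norm_integral_le_of_norm_le_const fun u _ ↦ hlead _ (by simp)
    rw [intervalIntegral.integral_sub (Continuous.intervalIntegrable (by fun_prop) _ _)
      (by simp), intervalIntegral.integral_const, add_sub_cancel_left, abs_of_pos hH] at e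
    have e₂ : ‖H • Z‖ = |b n₀| * P ^ (-σ₀) * H := by
      rw [norm_smul, hZ, Real.norm_of_nonneg hH.le, mul_comm]
    have e₃ := norm_sub_norm_le (H • Z) (∫ y in t..(t + H), D (c + y * Complex.I))
    rw [norm_sub_rev, e₂] at e₃
    linarith
  have hIeq : Complex.I • ∫ y in t..(t + H), D (c + y * Complex.I) =
      Complex.I • (∫ y in t..(t + H), D (σ₀ + y * Complex.I)) -
        (∫ x in σ₀..c, D (x + t * Complex.I)) +
        ∫ x in σ₀..c, D (x + (t + H : ℝ) * Complex.I) := by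
    linear_combination hrect
  have hnorm := congrArg norm hIeq
  rw [norm_smul, Complex.norm_I, one_mul] at hnorm
  rw [hnorm] at hright
  refine hright.trans ((norm_add_le _ _).trans ?_)
  refine add_le_add ((norm_sub_le _ _).trans ?_) (hhor _)
  rw [norm_smul, Complex.norm_I, one_mul]
  exact add_le_add hleft (hhor _)

open MeasureTheory in
theorem exists_le_integral_norm_dirichletPart_add (h : IsCompletedSeries b q σ₀ C β A Λ)
    (hb : ∃ n, b n ≠ 0) :
    ∃ V : ℝ → ℝ, Continuous V ∧ (∀ t, 0 ≤ V t) ∧ ∃ μ > (0 : ℝ), ∃ c₁ > (0 : ℝ), ∃ K > (0 : ℝ),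
      (∀ t H : ℝ, 0 < H → μ * H ≤
        (∫ u in t..(t + H), ‖dirichletPart q Λ (σ₀ + u * Complex.I)‖) + c₁ + V t + V (t + H)) ∧
      ∀ T : ℝ, 1 ≤ T → ∫ t in T..(4 * T), V t ≤ K * T := by
  obtain ⟨c, hc, μ, hμ, B, hB, hlow⟩ := h.exists_le_integral_norm_dirichletPart hb
  obtain ⟨K, hK0, hK⟩ := h.exists_integral_norm_sq_dirichletPart_le c
  have hLc := h.differentiable_dirichletPart.continuous
  have hwi : IntervalIntegrable (fun σ ↦ (σ - σ₀) ^ (-(1 / 2) : ℝ)) volume σ₀ c := by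
    have := (intervalIntegral.intervalIntegrable_rpow' (a := 0) (b := c - σ₀)
      (show (-1 : ℝ) < -(1 / 2) by norm_num)).comp_sub_right σ₀
    simpa using this
  have hw0 : 0 ≤ ∫ σ in σ₀..c, (σ - σ₀) ^ (-(1 / 2) : ℝ) :=
    intervalIntegral.integral_nonneg hc.le fun σ hσ ↦ Real.rpow_nonneg (sub_nonneg.2 hσ.1) _
  set W := ∫ σ in σ₀..c, (σ - σ₀) ^ (-(1 / 2) : ℝ) with hW
  let G : ℝ → ℝ → ℝ := fun t σ ↦ √(σ - σ₀) * ‖dirichletPart q Λ (σ + t * Complex.I)‖ ^ 2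
  have hGc : Continuous (Function.uncurry G) := by
    simp only [G, Function.uncurry_def]
    fun_prop
  have hsqrt : ∀ σ, σ₀ < σ → (σ - σ₀) ^ (-(1 / 2) : ℝ) = (√(σ - σ₀))⁻¹ := fun σ hσ ↦ by
    rw [Real.rpow_neg (sub_pos.2 hσ).le, Real.sqrt_eq_rpow]
  have hG0 : ∀ t, 0 ≤ ∫ σ in σ₀..c, G t σ := fun t ↦
    intervalIntegral.integral_nonneg hc.le fun σ _ ↦ by simp only [G]; positivity
  have hVc : Continuous fun t ↦ ∫ σ in σ₀..c, G t σ :=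
    intervalIntegral.continuous_parametric_intervalIntegral_of_continuous' hGc _ _
  have hhor : ∀ t : ℝ, ∫ σ in σ₀..c, ‖dirichletPart q Λ (σ + t * Complex.I)‖ ≤
      W + ∫ σ in σ₀..c, G t σ := fun t ↦ by
    have hGt : IntervalIntegrable (G t) volume σ₀ c :=
      (hGc.comp (by fun_prop : Continuous fun σ ↦ (t, σ))).intervalIntegrable _ _
    rw [hW, ← intervalIntegral.integral_add hwi hGt]
    refine intervalIntegral.integral_mono_on_of_le_Ioo hc.le
      (Continuous.intervalIntegrable (by fun_prop) _ _) (hwi.add hGt) fun σ hσ ↦ ?_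
    have hr : 0 < √(σ - σ₀) := Real.sqrt_pos.2 (sub_pos.2 hσ.1)
    simp only [G]
    rw [hsqrt σ hσ.1]
    set x := ‖dirichletPart q Λ (σ + t * Complex.I)‖
    have : (√(σ - σ₀))⁻¹ + √(σ - σ₀) * x ^ 2 - x =
        ((√(σ - σ₀) * x - 1 / 2) ^ 2 + 3 / 4) / √(σ - σ₀) := by
      field_simp
      ring
    have h2 : 0 ≤ ((√(σ - σ₀) * x - 1 / 2) ^ 2 + 3 / 4) / √(σ - σ₀) := by positivity
    linarith
  refine ⟨fun t ↦ B * ∫ σ in σ₀..c, G t σ, hVc.const_mul B, fun t ↦ mul_nonneg hB.le (hG0 t),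
    μ, hμ, 2 * B * W + 1, by positivity, B * K * W + 1, by positivity, fun t H hH ↦ ?_,
    fun T hT ↦ ?_⟩
  · have h₁ := mul_le_mul_of_nonneg_left (hhor t) hB.le
    have h₂ := mul_le_mul_of_nonneg_left (hhor (t + H)) hB.le
    linarith [hlow t H hH]
  · have hT0 : 0 < T := by linarith
    rw [intervalIntegral.integral_const_mul, intervalIntegral_intervalIntegral_swap]
    · have hle : ∫ σ in σ₀..c, ∫ t in T..(4 * T), G t σ ≤
          ∫ σ in σ₀..c, K * T * (σ - σ₀) ^ (-(1 / 2) : ℝ) := by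
        refine intervalIntegral.integral_mono_on_of_le_Ioo hc.le ?_ (hwi.const_mul _) fun σ hσ ↦ ?_
        · refine Continuous.intervalIntegrable ?_ _ _
          exact intervalIntegral.continuous_parametric_intervalIntegral_of_continuous'
            (f := fun σ t ↦ G t σ) (hGc.comp continuous_swap) _ _
        · have hr : 0 < σ - σ₀ := sub_pos.2 hσ.1
          simp only [G]
          rw [intervalIntegral.integral_const_mul, hsqrt σ hσ.1]
          calc _ ≤ √(σ - σ₀) * (K * T / (σ - σ₀)) := by
                gcongr
                exact hK T hT σ hσ.1 hσ.2.le
            _ = _ := by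
                have hs := Real.sqrt_pos.2 hr
                rw [div_eq_mul_inv, ← Real.mul_self_sqrt hr.le, Real.sqrt_mul_self hs.le]
                field_simp
      rw [intervalIntegral.integral_const_mul, ← hW] at hle
      have := mul_le_mul_of_nonneg_left hle hB.le
      linarith
    · exact (hGc.continuousOn.integrableOn_compact (isCompact_uIcc.prod isCompact_uIcc)).mono_set
        (Set.prod_mono Set.uIoc_subset_uIcc Set.uIoc_subset_uIcc)

end IsCompletedSeries

theorem exists_strictMono_alternating {r : ℝ → ℝ} {x : ℕ → ℝ} (hx : Monotone x) {s : Finset ℕ}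
    {m : ℕ} (hs : s.card = m + 1)
    (hpos : ∀ j ∈ s, ∃ u ∈ Set.Icc (x j) (x (j + 1)), 0 < r u)
    (hneg : ∀ j ∈ s, ∃ u ∈ Set.Icc (x j) (x (j + 1)), r u < 0) :
    ∃ t : Fin (m + 1) → ℝ, StrictMono t ∧
      (∀ i, ∃ j ∈ s, t i ∈ Set.Icc (x j) (x (j + 1))) ∧
      ∀ i : Fin m, r (t i.castSucc) * r (t i.succ) < 0 := by
  choose! p hp hrp using hpos
  choose! n hn hrn using hneg
  let e := s.orderEmbOfFin hs
  have he : ∀ i, e i ∈ s := s.orderEmbOfFin_mem hs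
  let t : Fin (m + 1) → ℝ := fun i ↦ if Even (i : ℕ) then p (e i) else n (e i)
  have ht : ∀ i, t i ∈ Set.Icc (x (e i)) (x (e i + 1)) := fun i ↦ by
    simp only [t]
    split_ifs
    exacts [hp _ (he i), hn _ (he i)]
  have hprod : ∀ i : Fin m, r (t i.castSucc) * r (t i.succ) < 0 := fun i ↦ by
    by_cases hi : Even (i : ℕ)
    · have hi' : ¬ Even ((i : ℕ) + 1) := by simpa [Nat.even_add_one] using hi
      simp only [t, Fin.val_castSucc, Fin.val_succ, if_pos hi, if_neg hi']
      exact mul_neg_of_pos_of_neg (hrp _ (he _)) (hrn _ (he _))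
    · have hi' : Even ((i : ℕ) + 1) := by simpa [Nat.even_add_one] using hi
      simp only [t, Fin.val_castSucc, Fin.val_succ, if_neg hi, if_pos hi']
      exact mul_neg_of_neg_of_pos (hrn _ (he _)) (hrp _ (he _))
  refine ⟨t, Fin.strictMono_iff_lt_succ.2 fun i ↦ lt_of_le_of_ne ?_ fun heq ↦ ?_,
    fun i ↦ ⟨e i, he i, ht i⟩, hprod⟩
  · exact (ht _).2.trans ((hx (Nat.succ_le_of_lt
      (e.strictMono (Fin.castSucc_lt_succ (i := i))))).trans (ht _).1)
  · have := hprod i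
    rw [heq] at this
    exact absurd this (mul_self_nonneg _).not_gt

open MeasureTheory in
theorem card_mul_le_integral {Q : ℝ → ℝ} (hQ : Continuous Q) (hQ0 : ∀ t, 0 ≤ Q t) {T H ε : ℝ}
    (hH : 0 < H) {n : ℕ} (hn : 2 * n * H ≤ T) {s : Finset ℕ} (hs : s ⊆ Finset.range n)
    (hε : ∀ j ∈ s, ∀ t ∈ Set.Icc (T + 2 * j * H) (T + 2 * j * H + H), ε ≤ Q t) :
    s.card * (ε * H) ≤ ∫ t in T..(2 * T), Q t := by
  have hint : ∀ x y, IntervalIntegrable Q volume x y := fun x y ↦ hQ.intervalIntegrable x y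
  have hnn : ∀ x y, x ≤ y → 0 ≤ ∫ t in x..y, Q t := fun x y hxy ↦
    intervalIntegral.integral_nonneg hxy fun t _ ↦ hQ0 t
  let x : ℕ → ℝ := fun j ↦ T + 2 * j * H
  have hblock : ∀ j ∈ s, ε * H ≤ ∫ t in x j..x (j + 1), Q t := fun j hj ↦ by
    have h₁ : ∫ _ in x j..(x j + H), ε ≤ ∫ t in x j..(x j + H), Q t :=
      intervalIntegral.integral_mono_on (by linarith) (by simp) (hint _ _) fun t ht ↦ hε j hj t ht
    have h₂ := intervalIntegral.integral_add_adjacent_intervals (hint (x j) (x j + H))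
      (hint (x j + H) (x (j + 1)))
    have h₃ := hnn (x j + H) (x (j + 1)) (by simp only [x]; push_cast; linarith)
    rw [intervalIntegral.integral_const, add_sub_cancel_left, smul_eq_mul] at h₁
    linarith
  calc _ = ∑ j ∈ s, ε * H := by simp
    _ ≤ ∑ j ∈ s, ∫ t in x j..x (j + 1), Q t := Finset.sum_le_sum hblock
    _ ≤ ∑ j ∈ Finset.range n, ∫ t in x j..x (j + 1), Q t :=
      Finset.sum_le_sum_of_subset_of_nonneg hs fun j _ _ ↦ hnn _ _ (by
        simp only [x]; push_cast; linarith)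
    _ = ∫ t in x 0..x n, Q t :=
      intervalIntegral.sum_integral_adjacent_intervals fun j _ ↦ hint _ _
    _ ≤ ∫ t in T..(2 * T), Q t := by
      have h₁ := intervalIntegral.integral_add_adjacent_intervals (hint T (T + 2 * n * H))
        (hint (T + 2 * n * H) (2 * T))
      have h₂ := hnn (T + 2 * n * H) (2 * T) (by linarith)
      simp only [x, Nat.cast_zero, mul_zero, zero_mul, add_zero]
      linarith

/-- A real function has `≫ T` sign changes in `[T, 2T]` as soon as the starting points of long
intervals on which it keeps its sign are controlled, in mean, by a nonnegative function. -/
theorem exists_sign_changes {r : ℝ → ℝ} {μ H₀ K : ℝ} (hμ : 0 < μ)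
    (h : ∀ H T : ℝ, H₀ ≤ H → 0 < H → H ≤ T → 1 ≤ T → ∃ Q : ℝ → ℝ, Continuous Q ∧ (∀ t, 0 ≤ Q t) ∧
      (∀ t ∈ Set.Icc T (2 * T), ((∀ u ∈ Set.Icc t (t + H), 0 ≤ r u) ∨
        ∀ u ∈ Set.Icc t (t + H), r u ≤ 0) → μ * H ≤ Q t) ∧
      ∫ t in T..(2 * T), Q t ≤ K * T) :
    ∃ d > (0 : ℝ), ∃ T₀ > (0 : ℝ), ∀ T : ℝ, T₀ ≤ T →
      ∃ m : ℕ, d * T ≤ (m : ℝ) ∧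
        ∃ t : Fin (m + 1) → ℝ, StrictMono t ∧ (∀ i, t i ∈ Set.Icc T (2 * T)) ∧
          ∀ i : Fin m, r (t i.castSucc) * r (t i.succ) < 0 := by
  classical
  set H : ℝ := max (max H₀ 1) (8 * K / μ)
  have hHH₀ : H₀ ≤ H := (le_max_left _ _).trans (le_max_left _ _)
  have hH1 : 1 ≤ H := (le_max_right _ _).trans (le_max_left _ _)
  have hHK : 8 * K ≤ μ * H := by
    rw [← div_le_iff₀' hμ]
    exact le_max_right _ _
  have hH : 0 < H := by linarith
  refine ⟨1 / (8 * H), by positivity, 8 * H, by positivity, fun T hT ↦ ?_⟩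
  have hT0 : 0 < T := by linarith
  obtain ⟨Q, hQ, hQ0, hQs, hQi⟩ := h H T hHH₀ hH (by linarith) (by linarith)
  set n := ⌊T / (2 * H)⌋₊
  have hn₁ : 2 * n * H ≤ T := by
    have := Nat.floor_le (show 0 ≤ T / (2 * H) by positivity)
    rw [le_div_iff₀ (by positivity)] at this
    linarith
  have hn₂ : T < 2 * (n + 1) * H := by
    have := Nat.lt_floor_add_one (T / (2 * H))
    rw [div_lt_iff₀ (by positivity)] at this
    linarith
  let x : ℕ → ℝ := fun j ↦ T + 2 * j * H
  have hxs : ∀ j, x (j + 1) = x j + 2 * H := fun j ↦ by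
    simp only [x]
    push_cast
    ring
  have hx : Monotone x := monotone_nat_of_le_succ fun j ↦ by rw [hxs]; linarith
  let P : ℕ → Prop := fun j ↦ (∃ u ∈ Set.Icc (x j) (x (j + 1)), 0 < r u) ∧
    ∃ u ∈ Set.Icc (x j) (x (j + 1)), r u < 0
  set good := (Finset.range n).filter P
  set bad := (Finset.range n).filter fun j ↦ ¬ P j
  have hcard : (good.card : ℝ) + bad.card = n := by
    have := Finset.card_filter_add_card_filter_not (s := Finset.range n) P
    rw [Finset.card_range] at this
    exact_mod_cast this
  have hbad : bad.card * (μ * H * H) ≤ K * T := by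
    refine (card_mul_le_integral hQ hQ0 hH hn₁ (Finset.filter_subset _ _)
      fun j hj t ht ↦ ?_).trans hQi
    have hjn : j + 1 ≤ n := Finset.mem_range.1 (Finset.mem_filter.1 hj).1
    have hjP : ¬ P j := (Finset.mem_filter.1 hj).2
    have hjn' : ((j : ℝ) + 1) * H ≤ n * H := by
      gcongr
      exact_mod_cast hjn
    have hj0 : 0 ≤ (j : ℝ) * H := by positivity
    have hsub : ∀ u ∈ Set.Icc t (t + H), u ∈ Set.Icc (x j) (x (j + 1)) := fun u hu ↦ by
      rw [hxs]
      exact ⟨ht.1.trans hu.1, by simp only [x]; linarith [hu.2, ht.2]⟩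
    refine hQs t ⟨by linarith [ht.1], by linarith [ht.2]⟩ ?_
    by_cases hpos : ∃ u ∈ Set.Icc (x j) (x (j + 1)), 0 < r u
    · left
      intro u hu
      by_contra! hneg
      exact hjP ⟨hpos, u, hsub u hu, hneg⟩
    · right
      push Not at hpos
      exact fun u hu ↦ hpos u (hsub u hu)
  have hbad' : (bad.card : ℝ) * (8 * H) ≤ T := by
    have h₁ : (bad.card : ℝ) * (μ * H * H) * 8 ≤ μ * H * T := by nlinarith
    have h₂ : 0 < μ * H := by positivity
    refine le_of_mul_le_mul_left ?_ h₂
    linarith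
  have hgood : T / (8 * H) + 1 ≤ good.card := by
    have h₁ : 0 < 8 * H := by positivity
    rw [← le_sub_iff_add_le, div_le_iff₀ h₁]
    nlinarith
  have hgood1 : 1 ≤ good.card := by
    have : (0 : ℝ) < T / (8 * H) := by positivity
    have : (0 : ℝ) < good.card := by linarith
    exact_mod_cast this
  obtain ⟨m, hm⟩ := Nat.exists_eq_add_of_le' hgood1
  refine ⟨m, ?_, ?_⟩
  · rw [hm] at hgood
    push_cast at hgood
    rw [one_div_mul_eq_div]
    linarith
  · obtain ⟨t, ht, hmem, hprod⟩ := exists_strictMono_alternating hx hm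
      (fun j hj ↦ (Finset.mem_filter.1 hj).2.1) fun j hj ↦ (Finset.mem_filter.1 hj).2.2
    refine ⟨t, ht, fun i ↦ ?_, hprod⟩
    obtain ⟨j, hj, hi⟩ := hmem i
    have hjn : j + 1 ≤ n := Finset.mem_range.1 (Finset.mem_filter.1 hj).1
    have h₀ := hx (Nat.zero_le j)
    have h₁ := hx hjn
    simp only [x, Nat.cast_zero, mul_zero, zero_mul, add_zero] at h₀ h₁
    exact ⟨h₀.trans hi.1, hi.2.trans (h₁.trans (by linarith))⟩

namespace IsCompletedSeries

variable {b : ℕ → ℝ} {q σ₀ C β A : ℝ} {Λ : ℂ → ℂ}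

open MeasureTheory in
theorem exists_sign_changes_on_line (h : IsCompletedSeries b q σ₀ C β A Λ) (hb : ∃ n, b n ≠ 0)
    {r : ℝ → ℝ} (hr : ∀ t : ℝ, Λ (σ₀ + t * Complex.I) = r t) :
    ∃ d > (0 : ℝ), ∃ T₀ > (0 : ℝ), ∀ T : ℝ, T₀ ≤ T →
      ∃ m : ℕ, d * T ≤ (m : ℝ) ∧
        ∃ t : Fin (m + 1) → ℝ, StrictMono t ∧ (∀ i, t i ∈ Set.Icc T (2 * T)) ∧
          ∀ i : Fin m, r (t i.castSucc) * r (t i.succ) < 0 := by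
  obtain ⟨V, hVc, hV0, μ, hμ, c₁, hc₁, K₁, hK₁, hlow, hVi⟩ :=
    h.exists_le_integral_norm_dirichletPart_add hb
  obtain ⟨K₂, hK₂, hmean⟩ := h.exists_integral_norm_sq_rotated_average_le
  obtain ⟨K₃, hK₃, hLΛ⟩ := h.exists_norm_dirichletPart_le σ₀
  have hΛc := h.differentiable.continuous
  have hLc := h.differentiable_dirichletPart.continuous
  refine exists_sign_changes (μ := μ / 2) (H₀ := 4 * c₁ / μ) (K := K₃ ^ 2 * K₂ / μ + 2 * K₁)
    (by positivity) fun H T hHc hH hHT hT ↦ ?_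
  rw [div_le_iff₀' hμ] at hHc
  have hT0 : 0 < T := by linarith
  set θ := Real.pi / 2 - 1 / T
  let E : ℝ → ℂ := fun u ↦ (Real.exp (θ * u) : ℂ) * Λ (σ₀ + u * Complex.I)
  have hEc : Continuous E := by fun_prop
  have hE : ∀ u, E u = ((Real.exp (θ * u) * r u : ℝ) : ℂ) := fun u ↦ by
    simp only [E]
    rw [hr, Complex.ofReal_mul]
  let I : ℝ → ℂ := fun t ↦ ∫ u in t..(t + H), E u
  have hIc : Continuous I := by
    have h₁ : Continuous fun t ↦ ∫ u in (0 : ℝ)..t, E u :=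
      intervalIntegral.continuous_primitive (fun _ _ ↦ hEc.intervalIntegrable _ _) 0
    have h₂ : I = fun t ↦ (∫ u in (0 : ℝ)..(t + H), E u) - ∫ u in (0 : ℝ)..t, E u := by
      funext t
      rw [intervalIntegral.integral_interval_sub_left] <;> exact hEc.intervalIntegrable _ _
    rw [h₂]
    exact (h₁.comp (continuous_add_const H)).sub h₁
  set D := K₃ ^ 2 * T ^ (1 - 2 * σ₀) / (μ * H) with hD
  have hD0 : 0 ≤ D := by positivity
  have hVs : Continuous fun t ↦ V (t + H) := hVc.comp (continuous_add_const H)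
  refine ⟨fun t ↦ D * ‖I t‖ ^ 2 + V t + V (t + H), by fun_prop,
    fun t ↦ by have := hV0 t; have := hV0 (t + H); positivity, fun t ht hsign ↦ ?_, ?_⟩
  · have hint : ∫ u in t..(t + H), ‖E u‖ = ‖I t‖ := by
      have hIr : I t = ((∫ u in t..(t + H), Real.exp (θ * u) * r u : ℝ) : ℂ) := by
        simp only [I, hE]
        rw [intervalIntegral.integral_ofReal]
      rw [hIr, Complex.norm_real, Real.norm_eq_abs]
      have hle : t ≤ t + H := by linarith
      rcases hsign with hs | hs
      · rw [abs_of_nonneg (intervalIntegral.integral_nonneg hle fun u hu ↦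
          mul_nonneg (Real.exp_pos _).le (hs u hu))]
        refine intervalIntegral.integral_congr fun u hu ↦ ?_
        rw [Set.uIcc_of_le hle] at hu
        simp only [hE, Complex.norm_real]
        exact Real.norm_of_nonneg (mul_nonneg (Real.exp_pos _).le (hs u hu))
      · rw [← abs_neg, ← intervalIntegral.integral_neg,
          abs_of_nonneg (intervalIntegral.integral_nonneg hle fun u hu ↦
            neg_nonneg.2 (mul_nonpos_of_nonneg_of_nonpos (Real.exp_pos _).le (hs u hu)))]
        refine intervalIntegral.integral_congr fun u hu ↦ ?_
        rw [Set.uIcc_of_le hle] at hu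
        simp only [hE, Complex.norm_real]
        exact Real.norm_of_nonpos (mul_nonpos_of_nonneg_of_nonpos (Real.exp_pos _).le (hs u hu))
    have hLE : ∫ u in t..(t + H), ‖dirichletPart q Λ (σ₀ + u * Complex.I)‖ ≤
        K₃ * T ^ (1 / 2 - σ₀) * ‖I t‖ := by
      rw [← hint, ← intervalIntegral.integral_const_mul]
      refine intervalIntegral.integral_mono_on (by linarith)
        (Continuous.intervalIntegrable (by fun_prop) _ _)
        (Continuous.intervalIntegrable (by fun_prop) _ _) fun u hu ↦ ?_
      refine (hLΛ σ₀ u T le_rfl le_rfl hT ⟨ht.1.trans hu.1, ?_⟩).trans_eq ?_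
      · linarith [hu.2, ht.2]
      · simp only [E]
        rw [norm_mul, Complex.norm_real, Real.norm_of_nonneg (Real.exp_pos _).le]
    have hl := hlow t H hH
    have hμH : 0 < μ * H := by positivity
    set X := K₃ * T ^ (1 / 2 - σ₀) * ‖I t‖
    have hX : D * ‖I t‖ ^ 2 = X ^ 2 / (μ * H) := by
      simp only [X, D]
      rw [mul_pow, mul_pow, ← Real.rpow_natCast (T ^ _) 2, ← Real.rpow_mul hT0.le]
      push_cast
      ring_nf
    have hX' : X ≤ μ * H / 4 + X ^ 2 / (μ * H) := by
      have : μ * H / 4 + X ^ 2 / (μ * H) - X = (X - μ * H / 2) ^ 2 / (μ * H) := by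
        field_simp
        ring
      have h2 : 0 ≤ (X - μ * H / 2) ^ 2 / (μ * H) := by positivity
      linarith
    change μ / 2 * H ≤ D * ‖I t‖ ^ 2 + V t + V (t + H)
    rw [hX]
    linarith
  · have hi : ∀ {f : ℝ → ℝ} {x y : ℝ}, Continuous f → IntervalIntegrable f volume x y :=
      fun hf ↦ hf.intervalIntegrable _ _
    have hDI : Continuous fun t ↦ D * ‖I t‖ ^ 2 := by fun_prop
    have hadd : ∫ t in T..(2 * T), D * ‖I t‖ ^ 2 + V t + V (t + H) =
        D * (∫ t in T..(2 * T), ‖I t‖ ^ 2) + (∫ t in T..(2 * T), V t) +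
          ∫ t in (T + H)..(2 * T + H), V t := by
      rw [← intervalIntegral.integral_comp_add_right V, ← intervalIntegral.integral_const_mul,
        ← intervalIntegral.integral_add (hi hDI) (hi hVc),
        ← intervalIntegral.integral_add
          (hi (f := fun t ↦ D * ‖I t‖ ^ 2 + V t) (hDI.add hVc)) (hi hVs)]
    refine hadd.trans_le ?_
    have h₁ : D * ∫ t in T..(2 * T), ‖I t‖ ^ 2 ≤ K₃ ^ 2 * K₂ / μ * T := by
      calc _ ≤ D * (K₂ * H * T ^ (2 * σ₀)) :=
            mul_le_mul_of_nonneg_left (hmean T hT H hH) hD0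
        _ = K₃ ^ 2 * K₂ / μ * (T ^ (1 - 2 * σ₀) * T ^ (2 * σ₀)) := by
            rw [hD]
            field_simp
        _ = _ := by rw [← Real.rpow_add hT0, sub_add_cancel, Real.rpow_one]
    have hmono : ∀ x y, T ≤ x → x ≤ y → y ≤ 4 * T → ∫ t in x..y, V t ≤ K₁ * T :=
      fun x y hx hxy hy ↦ (intervalIntegral.integral_mono_interval hx hxy hy
        (.of_forall hV0) (hi hVc)).trans (hVi T hT)
    have h₂ := hmono T (2 * T) le_rfl (by linarith) (by linarith)
    have h₃ := hmono (T + H) (2 * T + H) (by linarith) (by linarith) (by linarith)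
    linarith

end IsCompletedSeries

theorem heckeSum_eq_expSeries (a : ℕ → ℝ) (q : ℝ) (w : ℂ) :
    heckeSum a (((-(q / (2 * Real.pi) * w.im) : ℝ) : ℂ) +
      ((q / (2 * Real.pi) * w.re : ℝ) : ℂ) * Complex.I) = expSeries (fun n ↦ a (n + 1)) q w := by
  refine tsum_congr fun n ↦ ?_
  congr 2
  have hπ : (Real.pi : ℂ) ≠ 0 := by exact_mod_cast Real.pi_ne_zero
  conv_rhs => rw [← Complex.re_add_im w]
  push_cast
  field_simp
  ring_nf
  rw [Complex.I_sq]
  ring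

theorem expSeries_add_div_two {b b' : ℕ → ℝ} {C β q : ℝ}
    (hb : ∀ n, |b n| ≤ C * ((n : ℝ) + 1) ^ β) (hb' : ∀ n, |b' n| ≤ C * ((n : ℝ) + 1) ^ β)
    (hq : 0 < q) {w : ℂ} (hw : 0 < w.re) :
    expSeries (fun n ↦ (b n + b' n) / 2) q w = (expSeries b q w + expSeries b' q w) / 2 := by
  rw [← (((hasSum_expSeries hb hq hw).add (hasSum_expSeries hb' hq hw)).div_const 2).tsum_eq]
  refine tsum_congr fun n ↦ ?_
  push_cast
  ring

open ComplexConjugate in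
theorem IsCompletedSeries.apply_conj {b : ℕ → ℝ} {q σ₀ C β A : ℝ} {Λ : ℂ → ℂ}
    (h : IsCompletedSeries b q σ₀ C β A Λ) (s : ℂ) : Λ (conj s) = conj (Λ s) := by
  have hcpow : ∀ {x : ℝ}, 0 < x → ∀ z : ℂ, (x : ℂ) ^ conj z = conj ((x : ℂ) ^ z) := fun hx z ↦ by
    rw [Complex.cpow_conj _ _
      (by rw [Complex.arg_ofReal_of_nonneg hx.le]; exact Real.pi_ne_zero.symm),
      Complex.conj_ofReal]
  have heq : (conj ∘ Λ ∘ conj) = Λ := by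
    refine AnalyticOnNhd.eq_of_eventuallyEq (𝕜 := ℂ) (z₀ := ((β + 2 : ℝ) : ℂ))
      (fun z _ ↦ Differentiable.analyticAt (fun z ↦ ?_) z)
      (fun z _ ↦ h.differentiable.analyticAt z) ?_
    · exact differentiableAt_conj_conj_iff.2 (h.differentiable _)
    have hU : {z : ℂ | β + 1 < z.re} ∈ nhds ((β + 2 : ℝ) : ℂ) :=
      (isOpen_lt continuous_const Complex.continuous_re).mem_nhds (by simp)
    filter_upwards [hU] with z hz
    have hz : β + 1 < z.re := hz
    simp only [Function.comp_apply]
    rw [h.eq_mul_tsum z hz, h.eq_mul_tsum (conj z) (by simpa using hz), map_mul, map_mul,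
      ← map_neg, hcpow h.pos, Complex.Gamma_conj, Complex.conj_tsum, Complex.conj_conj,
      Complex.conj_conj]
    congr 1
    refine tsum_congr fun n ↦ ?_
    have := hcpow (show (0 : ℝ) < (n : ℝ) + 1 by positivity) (-z)
    push_cast at this
    rw [map_mul, this, Complex.conj_conj, Complex.conj_ofReal]
  rw [← congrFun heq s]
  simp

/-- On the symmetry line of its functional equation, a completed series with real coefficients is
real-valued. -/
theorem IsCompletedSeries.eq_ofReal_re {b : ℕ → ℝ} {q σ₀ C β A : ℝ} {Λ : ℂ → ℂ}
    (h : IsCompletedSeries b q σ₀ C β A Λ) (hfe : ∀ s, Λ (2 * σ₀ - s) = Λ s) (t : ℝ) :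
    Λ (σ₀ + t * Complex.I) = ((Λ (σ₀ + t * Complex.I)).re : ℝ) := by
  refine (Complex.conj_eq_iff_re.1 ?_).symm
  rw [← h.apply_conj, ← hfe (σ₀ + t * Complex.I)]
  congr 1
  simp
  ring

/-- In the Hecke-pair setup, with nonvanishing `a + a'` and the uniform cusp
bounds `|f(x+iy)|, |f'(x+iy)| ≤ 𝒜 y^{−σ₀}`, there are `d > 0` and `T₀ > 0` such that for all
`T ≥ T₀` the real-valued function `t ↦ R(t)` has at least `d·T` sign changes in `[T, 2T]`. -/
theorem stmt_17 (k N : ℕ) (hk : 0 < k) (hN : 0 < N)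
    (σ₀ : ℝ) (hσ₀ : σ₀ = (k : ℝ) / 2 + 1 / 4)
    (a a' : ℕ → ℝ) (C β : ℝ) (hC : 0 < C) (hβ : 0 < β)
    (ha : ∀ n : ℕ, |a n| ≤ C * (n : ℝ) ^ β)
    (ha' : ∀ n : ℕ, |a' n| ≤ C * (n : ℝ) ^ β)
    (Λ Λ' : ℂ → ℂ)
    (hΛdiff : Differentiable ℂ Λ) (hΛ'diff : Differentiable ℂ Λ')
    (hΛ : ∀ s : ℂ, β + 1 < s.re →
      Λ s = ((2 * Real.pi / Real.sqrt (4 * (N : ℝ)) : ℝ) : ℂ) ^ (-s) * Complex.Gamma s *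
        ∑' n : ℕ, (a (n + 1) : ℂ) * ((n : ℂ) + 1) ^ (-s))
    (hΛ' : ∀ s : ℂ, β + 1 < s.re →
      Λ' s = ((2 * Real.pi / Real.sqrt (4 * (N : ℝ)) : ℝ) : ℂ) ^ (-s) * Complex.Gamma s *
        ∑' n : ℕ, (a' (n + 1) : ℂ) * ((n : ℂ) + 1) ^ (-s))
    (hFE : ∀ s : ℂ, Λ s = Λ' ((k : ℂ) + 1 / 2 - s))
    (hstrip : ∀ σ₁ σ₂ : ℝ, ∃ C' B' : ℝ, ∀ σ t : ℝ, σ₁ ≤ σ → σ ≤ σ₂ →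
      ‖Λ ((σ : ℂ) + (t : ℂ) * Complex.I)‖ +
        ‖Λ' ((σ : ℂ) + (t : ℂ) * Complex.I)‖ ≤
          C' * (1 + |t|) ^ B' * Real.exp (-Real.pi * |t| / 2))
    (R : ℝ → ℂ)
    (hR : ∀ t : ℝ, R t =
      (Λ ((σ₀ : ℂ) + (t : ℂ) * Complex.I) + Λ' ((σ₀ : ℂ) + (t : ℂ) * Complex.I)) / 2)
    (hnz : ∃ n : ℕ, a (n + 1) + a' (n + 1) ≠ 0)
    (𝒜 : ℝ)
    (hf : ∀ x y : ℝ, 0 < y →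
      ‖heckeSum a ((x : ℂ) + (y : ℂ) * Complex.I)‖ ≤ 𝒜 * y ^ (-σ₀))
    (hf' : ∀ x y : ℝ, 0 < y →
      ‖heckeSum a' ((x : ℂ) + (y : ℂ) * Complex.I)‖ ≤ 𝒜 * y ^ (-σ₀)) :
    ∃ d > (0 : ℝ), ∃ T₀ > (0 : ℝ), ∀ T : ℝ, T₀ ≤ T →
      ∃ m : ℕ, d * T ≤ (m : ℝ) ∧
        ∃ t : Fin (m + 1) → ℝ, StrictMono t ∧ (∀ i, t i ∈ Set.Icc T (2 * T)) ∧
          ∀ i : Fin m, (R (t i.castSucc)).re * (R (t i.succ)).re < 0 := by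
  set q := 2 * Real.pi / Real.sqrt (4 * (N : ℝ)) with hq_def
  have hq : 0 < q := by positivity
  have hshift : ∀ {c : ℕ → ℝ}, (∀ n : ℕ, |c n| ≤ C * (n : ℝ) ^ β) →
      ∀ n : ℕ, |c (n + 1)| ≤ C * ((n : ℝ) + 1) ^ β := fun hc n ↦ by
    simpa using hc (n + 1)
  have hb := hshift ha
  have hb' := hshift ha'
  have hseries : ∀ {c : ℕ → ℝ}, (∀ x y : ℝ, 0 < y →
      ‖heckeSum c ((x : ℂ) + (y : ℂ) * Complex.I)‖ ≤ 𝒜 * y ^ (-σ₀)) → ∀ w : ℂ, 0 < w.re →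
      ‖expSeries (fun n ↦ c (n + 1)) q w‖ ≤
        𝒜 * (q / (2 * Real.pi)) ^ (-σ₀) * w.re ^ (-σ₀) := fun hc w hw ↦ by
    rw [← heckeSum_eq_expSeries, mul_assoc, ← Real.mul_rpow (by positivity) hw.le]
    exact hc _ _ (by positivity)
  have hS : IsCompletedSeries (fun n ↦ (a (n + 1) + a' (n + 1)) / 2) q σ₀ C β
      (𝒜 * (q / (2 * Real.pi)) ^ (-σ₀)) fun s ↦ (Λ s + Λ' s) / 2 :=
    { abs_le := fun n ↦ by
        rw [abs_div, abs_two]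
        linarith [abs_add_le (a (n + 1)) (a' (n + 1)), hb n, hb' n]
      exponent_nonneg := hβ.le
      pos := hq
      half_le := by
        have : (1 : ℝ) ≤ k := by exact_mod_cast hk
        linarith
      norm_expSeries_le := fun w hw ↦ by
        rw [expSeries_add_div_two hb hb' hq hw, norm_div, Complex.norm_two]
        linarith [norm_add_le (expSeries (fun n ↦ a (n + 1)) q w)
          (expSeries (fun n ↦ a' (n + 1)) q w), hseries hf w hw, hseries hf' w hw]
      differentiable := (hΛdiff.add hΛ'diff).div_const 2
      eq_mul_tsum := fun s hs ↦ by
        rw [hΛ s hs, hΛ' s hs, ← mul_add,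
          ← (summable_mul_cpow_neg hb hs).tsum_add (summable_mul_cpow_neg hb' hs), mul_div_assoc,
          ← tsum_div_const]
        congr 1
        refine tsum_congr fun n ↦ ?_
        push_cast
        ring }
  have hk2 : (2 * σ₀ : ℂ) = k + 1 / 2 := by
    rw [hσ₀]
    push_cast
    ring
  obtain ⟨n, hn⟩ := hnz
  refine hS.exists_sign_changes_on_line ⟨n, div_ne_zero hn two_ne_zero⟩ (r := fun t ↦ (R t).re)
    fun t ↦ ?_
  rw [hR]
  refine hS.eq_ofReal_re (fun s ↦ ?_) t
  rw [hk2, hFE s, hFE (k + 1 / 2 - s), sub_sub_cancel, add_comm]
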